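/- arXiv:2104.08596 — 6 statements merged into one kernel-verified Lean document; each statement's English description precedes it below -/
import Mathlib

section
/- For every real ν and every x > 0, the Havelock function h_ν is twice differentiable at x and satisfies the inhomogeneous ordinary differential equation x·h_ν''(x) = (x − ν)·h_ν(x) − 2/π. -/
/-- The Havelock function `h_ν(x) = (2/π) ∫₀^{π/2} sin(x·tan θ − ν·θ) dθ`. -/
noncomputable def havelockH (ν x : ℝ) : ℝ :=
  (2 / Real.pi) * ∫ θ in (0:ℝ)..(Real.pi / 2), Real.sin (x * Real.tan θ - ν * θ)

open MeasureTheory Set Filter Topology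

/-- If `f n` has derivative `M n + e n` and `M n` has derivative `R n` on `(0, ∞)`, where `f n → g`,
`R n → r` and `e n → 0` pointwise with a locally integrable bound on `R n` and `e n`, then `g` has
derivative `x ↦ L + ∫ s in 1..x, r s` for some constant `L`. -/
theorem exists_hasDerivAt_of_tendsto_of_second_deriv
    {f M e R : ℕ → ℝ → ℝ} {g r B : ℝ → ℝ}
    (hf : ∀ n, ∀ x, 0 < x → HasDerivAt (f n) (M n x + e n x) x)
    (hM : ∀ n, ∀ x, 0 < x → HasDerivAt (M n) (R n x) x)
    (he : ∀ n, ContinuousOn (e n) (Ioi 0)) (hR : ∀ n, ContinuousOn (R n) (Ioi 0))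
    (hB : ContinuousOn B (Ioi 0))
    (heB : ∀ n, ∀ x, 0 < x → |e n x| ≤ B x) (hRB : ∀ n, ∀ x, 0 < x → |R n x| ≤ B x)
    (he0 : ∀ x, 0 < x → Tendsto (fun n => e n x) atTop (𝓝 0))
    (hRr : ∀ x, 0 < x → Tendsto (fun n => R n x) atTop (𝓝 (r x)))
    (hfg : ∀ x, 0 < x → Tendsto (fun n => f n x) atTop (𝓝 (g x)))
    (hr : ContinuousOn r (Ioi 0)) :
    ∃ L : ℝ, ∀ x, 0 < x → HasDerivAt g (L + ∫ s in (1 : ℝ)..x, r s) x := by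
  have hsub : ∀ {x : ℝ}, 0 < x → uIcc 1 x ⊆ Ioi 0 := fun {x} hx y hy =>
    lt_of_lt_of_le (lt_min one_pos hx) hy.1
  have hII : ∀ {φ : ℝ → ℝ}, ContinuousOn φ (Ioi 0) → ∀ {x : ℝ}, 0 < x →
      IntervalIntegrable φ volume 1 x := fun hφ _ hx =>
    (hφ.mono (hsub hx)).intervalIntegrable
  have hprim : ∀ {φ : ℝ → ℝ}, ContinuousOn φ (Ioi 0) → ∀ x, 0 < x →
      HasDerivAt (fun u => ∫ s in (1 : ℝ)..u, φ s) (φ x) x := fun {φ} hφ x hx =>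
    intervalIntegral.integral_hasDerivAt_right (hII hφ hx)
      (hφ.stronglyMeasurableAtFilter isOpen_Ioi x hx) (hφ.continuousAt (Ioi_mem_nhds hx))
  have hprimc : ∀ {φ : ℝ → ℝ}, ContinuousOn φ (Ioi 0) →
      ContinuousOn (fun u => ∫ s in (1 : ℝ)..u, φ s) (Ioi 0) := fun hφ x hx =>
    (hprim hφ x hx).continuousAt.continuousWithinAt
  have hMeq : ∀ n, ∀ x, 0 < x → ∫ s in (1 : ℝ)..x, R n s = M n x - M n 1 := fun n x hx =>
    intervalIntegral.integral_eq_sub_of_hasDerivAt (fun y hy => hM n y (hsub hx hy)) (hII (hR n) hx)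
  have hEc : ∀ n, ContinuousOn (fun t => (∫ s in (1 : ℝ)..t, R n s) + e n t) (Ioi 0) := fun n =>
    (hprimc (hR n)).add (he n)
  have hfeq : ∀ n, ∀ x, 0 < x → M n 1 * (x - 1) =
      f n x - f n 1 - ∫ t in (1 : ℝ)..x, ((∫ s in (1 : ℝ)..t, R n s) + e n t) := by
    intro n x hx
    have h1 : ∫ t in (1 : ℝ)..x, (M n 1 + ((∫ s in (1 : ℝ)..t, R n s) + e n t)) =
        f n x - f n 1 := by
      refine intervalIntegral.integral_eq_sub_of_hasDerivAt (fun y hy => ?_)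
        (hII (continuousOn_const.add (hEc n)) hx)
      have h2 := hf n y (hsub hx hy)
      rw [hMeq n y (hsub hx hy), ← add_assoc, add_sub_cancel]
      exact h2
    rw [intervalIntegral.integral_add intervalIntegrable_const (hII (hEc n) hx),
      intervalIntegral.integral_const, smul_eq_mul] at h1
    linarith
  have hRlim : ∀ x, 0 < x → Tendsto (fun n => ∫ s in (1 : ℝ)..x, R n s) atTop
      (𝓝 (∫ s in (1 : ℝ)..x, r s)) := by
    intro x hx
    refine intervalIntegral.tendsto_integral_filter_of_dominated_convergence B ?_ ?_ (hII hB hx) ?_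
    · exact Eventually.of_forall fun n => (hII (hR n) hx).aestronglyMeasurable_restrict_uIoc
    · exact Eventually.of_forall fun n => Eventually.of_forall fun y hy =>
        hRB n y (hsub hx (uIoc_subset_uIcc hy))
    · exact Eventually.of_forall fun y hy => hRr y (hsub hx (uIoc_subset_uIcc hy))
  have hElim : ∀ x, 0 < x →
      Tendsto (fun n => ∫ t in (1 : ℝ)..x, ((∫ s in (1 : ℝ)..t, R n s) + e n t)) atTop
        (𝓝 (∫ t in (1 : ℝ)..x, ∫ s in (1 : ℝ)..t, r s)) := by
    intro x hx
    refine intervalIntegral.tendsto_integral_filter_of_dominated_convergence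
      (fun t => |∫ s in (1 : ℝ)..t, B s| + B t) ?_ ?_ (hII ((hprimc hB).abs.add hB) hx) ?_
    · exact Eventually.of_forall fun n => (hII (hEc n) hx).aestronglyMeasurable_restrict_uIoc
    · refine Eventually.of_forall fun n => Eventually.of_forall fun y hy => ?_
      have hy0 : 0 < y := hsub hx (uIoc_subset_uIcc hy)
      refine (norm_add_le _ _).trans (add_le_add ?_ (heB n y hy0))
      refine intervalIntegral.norm_integral_le_abs_of_norm_le ?_ (hII hB hy0)
      exact ae_restrict_of_forall_mem measurableSet_uIoc fun s hs =>
        hRB n s (hsub hy0 (uIoc_subset_uIcc hs))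
    · refine Eventually.of_forall fun y hy => ?_
      have hy0 : 0 < y := hsub hx (uIoc_subset_uIcc hy)
      simpa using (hRlim y hy0).add (he0 y hy0)
  set P : ℝ → ℝ := fun x => ∫ t in (1 : ℝ)..x, ∫ s in (1 : ℝ)..t, r s
  have hlim : ∀ x, 0 < x → Tendsto (fun n => M n 1 * (x - 1)) atTop (𝓝 (g x - g 1 - P x)) := by
    intro x hx
    simp only [fun n => hfeq n x hx]
    exact ((hfg x hx).sub (hfg 1 one_pos)).sub (hElim x hx)
  obtain ⟨L, hL⟩ : ∃ L, Tendsto (fun n => M n 1) atTop (𝓝 L) :=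
    ⟨_, by simpa [show (2 : ℝ) - 1 = 1 by norm_num] using hlim 2 two_pos⟩
  have hg : ∀ x, 0 < x → g x = g 1 + L * (x - 1) + P x := by
    intro x hx
    linarith [tendsto_nhds_unique (hlim x hx) (hL.mul_const (x - 1))]
  refine ⟨L, fun x hx => ?_⟩
  have h1 : HasDerivAt (fun x => g 1 + L * (x - 1) + P x) (L + ∫ s in (1 : ℝ)..x, r s) x := by
    have h2 := ((((hasDerivAt_id x).sub_const 1).const_mul L).const_add (g 1)).add
      (hprim (hprimc hr) x hx)
    simpa using! h2
  exact h1.congr_of_eventuallyEq (eventually_of_mem (Ioi_mem_nhds hx) hg)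

/-- The phase `x t - ν arctan t` of the Havelock integral after substituting `t = tan θ`. -/
noncomputable def havelockPhase (ν x t : ℝ) : ℝ := x * t - ν * Real.arctan t

theorem continuous_havelockPhase (ν x : ℝ) : Continuous (havelockPhase ν x) := by
  unfold havelockPhase
  fun_prop

theorem hasDerivAt_havelockPhase_left (ν x t : ℝ) :
    HasDerivAt (fun y => havelockPhase ν y t) t x := by
  simpa [havelockPhase] using ((hasDerivAt_id x).mul_const t).sub_const (ν * Real.arctan t)

theorem hasDerivAt_havelockPhase_right (ν x t : ℝ) :
    HasDerivAt (havelockPhase ν x) (x - ν / (1 + t ^ 2)) t := by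
  have h := ((hasDerivAt_id t).const_mul x).sub ((Real.hasDerivAt_arctan t).const_mul ν)
  simpa [havelockPhase, div_eq_mul_inv] using! h

theorem one_add_sq_ne_zero (t : ℝ) : 1 + t ^ 2 ≠ 0 := by positivity

/-- The Havelock integral truncated at `tan θ = T`. -/
noncomputable def havelockTrunc (ν T x : ℝ) : ℝ :=
  ∫ t in (0 : ℝ)..T, Real.sin (havelockPhase ν x t) / (1 + t ^ 2)

/-- The derivative of the truncated Havelock integral. -/
noncomputable def havelockTruncDeriv (ν T x : ℝ) : ℝ :=
  ∫ t in (0 : ℝ)..T, t * Real.cos (havelockPhase ν x t) / (1 + t ^ 2)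

theorem hasDerivAt_havelockTrunc (ν T x : ℝ) :
    HasDerivAt (havelockTrunc ν T) (havelockTruncDeriv ν T x) x := by
  have hc := continuous_havelockPhase ν
  have hF : ∀ y, Continuous fun t => Real.sin (havelockPhase ν y t) / (1 + t ^ 2) := fun y =>
    (Real.continuous_sin.comp (hc y)).div (by fun_prop) one_add_sq_ne_zero
  have hF' : ∀ y, Continuous fun t => t * Real.cos (havelockPhase ν y t) / (1 + t ^ 2) := fun y =>
    (continuous_id.mul (Real.continuous_cos.comp (hc y))).div (by fun_prop) one_add_sq_ne_zero
  refine (intervalIntegral.hasDerivAt_integral_of_dominated_loc_of_deriv_le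
    (F := fun y t => Real.sin (havelockPhase ν y t) / (1 + t ^ 2)) (bound := fun _ => 1)
    (F' := fun y t => t * Real.cos (havelockPhase ν y t) / (1 + t ^ 2))
    univ_mem (Eventually.of_forall fun y => (hF y).aestronglyMeasurable)
    ((hF x).intervalIntegrable _ _) (hF' x).aestronglyMeasurable
    (Eventually.of_forall fun t _ y _ => ?_) intervalIntegrable_const
    (Eventually.of_forall fun t _ y _ => ?_)).2
  · rw [Real.norm_eq_abs, abs_div, abs_mul, abs_of_pos (by positivity : 0 < 1 + t ^ 2),
      div_le_one (by positivity)]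
    have h1 := Real.abs_cos_le_one (havelockPhase ν y t)
    nlinarith [abs_nonneg t, sq_abs t, sq_nonneg (|t| - 1)]
  · convert! ((hasDerivAt_havelockPhase_left ν y t).sin).div_const (1 + t ^ 2) using 1
    ring

theorem hasDerivAt_havelockTruncDeriv (ν T : ℝ) {x : ℝ} (hx : x ≠ 0) :
    HasDerivAt (havelockTruncDeriv ν T)
      (((x - ν) * havelockTrunc ν T x - 1 + Real.cos (havelockPhase ν x T)) / x) x := by
  have hc := continuous_havelockPhase ν
  have hS : ∀ y, Continuous fun t => Real.sin (havelockPhase ν y t) / (1 + t ^ 2) := fun y =>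
    (Real.continuous_sin.comp (hc y)).div (by fun_prop) one_add_sq_ne_zero
  have hF : ∀ y, Continuous fun t => t * Real.cos (havelockPhase ν y t) / (1 + t ^ 2) := fun y =>
    (continuous_id.mul (Real.continuous_cos.comp (hc y))).div (by fun_prop) one_add_sq_ne_zero
  have hF' : ∀ y, Continuous fun t => -(t ^ 2 * Real.sin (havelockPhase ν y t) / (1 + t ^ 2)) :=
    fun y => (((continuous_pow 2).mul (Real.continuous_sin.comp (hc y))).div (by fun_prop)
      one_add_sq_ne_zero).neg
  have hderiv := (intervalIntegral.hasDerivAt_integral_of_dominated_loc_of_deriv_le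
    (F := fun y t => t * Real.cos (havelockPhase ν y t) / (1 + t ^ 2)) (bound := fun _ => 1)
    (a := 0) (b := T) (μ := volume)
    (F' := fun y t => -(t ^ 2 * Real.sin (havelockPhase ν y t) / (1 + t ^ 2)))
    univ_mem (Eventually.of_forall fun y => (hF y).aestronglyMeasurable)
    ((hF x).intervalIntegrable _ _) (hF' x).aestronglyMeasurable
    (Eventually.of_forall fun t _ y _ => by
      rw [norm_neg, Real.norm_eq_abs, abs_div, abs_mul,
        abs_of_pos (by positivity : 0 < 1 + t ^ 2), abs_of_nonneg (sq_nonneg t),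
        div_le_one (by positivity)]
      nlinarith [Real.abs_sin_le_one (havelockPhase ν y t), sq_nonneg t])
    intervalIntegrable_const
    (Eventually.of_forall fun t _ y _ => by
      convert! (((hasDerivAt_havelockPhase_left ν y t).cos).const_mul t).div_const (1 + t ^ 2)
        using 1
      ring)).2
  convert! hderiv using 1
  have hFTC : ∫ t in (0 : ℝ)..T, Real.sin (havelockPhase ν x t) * (x - ν / (1 + t ^ 2)) =
      -Real.cos (havelockPhase ν x T) - -Real.cos (havelockPhase ν x 0) := by
    refine intervalIntegral.integral_eq_sub_of_hasDerivAt
      (f := fun t => -Real.cos (havelockPhase ν x t)) (fun t _ => ?_) ?_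
    · convert! ((hasDerivAt_havelockPhase_right ν x t).cos).neg using 1
      ring
    · refine Continuous.intervalIntegrable ?_ _ _
      exact (Real.continuous_sin.comp (hc x)).mul
        (continuous_const.sub (continuous_const.div (by fun_prop) one_add_sq_ne_zero))
  have h0 : havelockPhase ν x 0 = 0 := by simp [havelockPhase]
  rw [h0, Real.cos_zero] at hFTC
  have hlin : ∫ t in (0 : ℝ)..T, Real.sin (havelockPhase ν x t) * (x - ν / (1 + t ^ 2)) =
      (x - ν) * havelockTrunc ν T x -
        x * ∫ t in (0 : ℝ)..T, -(t ^ 2 * Real.sin (havelockPhase ν x t) / (1 + t ^ 2)) := by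
    rw [havelockTrunc, ← intervalIntegral.integral_const_mul, ← intervalIntegral.integral_const_mul,
      ← intervalIntegral.integral_sub]
    · refine intervalIntegral.integral_congr fun t _ => ?_
      have := one_add_sq_ne_zero t
      field_simp
      ring
    · exact ((hS x).const_mul _).intervalIntegrable _ _
    · exact ((hF' x).const_mul _).intervalIntegrable _ _
  rw [div_eq_iff hx]
  linarith

theorem havelockTrunc_eq_integral_arctan (ν T x : ℝ) :
    havelockTrunc ν T x =
      ∫ θ in (0 : ℝ)..Real.arctan T, Real.sin (x * Real.tan θ - ν * θ) := by
  have h := intervalIntegral.integral_comp_mul_deriv'' (a := 0) (b := T) (f := Real.arctan)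
    (f' := fun t => 1 / (1 + t ^ 2)) (g := fun θ => Real.sin (x * Real.tan θ - ν * θ))
    Real.continuous_arctan.continuousOn
    (fun t _ => (Real.hasDerivAt_arctan t).hasDerivWithinAt)
    (continuous_const.div (by fun_prop) one_add_sq_ne_zero).continuousOn
    (by
      refine Real.continuous_sin.comp_continuousOn ?_
      refine ContinuousOn.sub (continuousOn_const.mul ?_) (by fun_prop)
      refine Real.continuousOn_tan_Ioo.mono ?_
      rintro _ ⟨t, _, rfl⟩
      exact Real.arctan_mem_Ioo t)
  rw [Real.arctan_zero] at h
  rw [← h, havelockTrunc]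
  refine intervalIntegral.integral_congr fun t _ => ?_
  simp [havelockPhase, Real.tan_arctan, div_eq_mul_inv]

theorem measurable_havelock_integrand (ν x : ℝ) :
    Measurable fun θ : ℝ => Real.sin (x * Real.tan θ - ν * θ) := by
  have : Measurable Real.tan := by
    simp only [funext Real.tan_eq_sin_div_cos]
    fun_prop
  fun_prop

theorem tendsto_havelockTrunc (ν x : ℝ) :
    Tendsto (fun T => havelockTrunc ν T x) atTop
      (𝓝 (∫ θ in (0 : ℝ)..(Real.pi / 2), Real.sin (x * Real.tan θ - ν * θ))) := by
  simp only [havelockTrunc_eq_integral_arctan]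
  have hint : ∀ a b : ℝ,
      IntervalIntegrable (fun θ => Real.sin (x * Real.tan θ - ν * θ)) volume a b := fun a b =>
    (intervalIntegrable_const (c := (1 : ℝ))).mono_fun
      (measurable_havelock_integrand ν x).aestronglyMeasurable
      (Eventually.of_forall fun θ => by simpa using Real.abs_sin_le_one _)
  exact ((intervalIntegral.continuous_primitive hint 0).tendsto (Real.pi / 2)).comp
    (Real.tendsto_arctan_atTop.mono_right nhdsWithin_le_nhds)

theorem abs_havelockTrunc_le (ν x : ℝ) {T : ℝ} (hT : 0 ≤ T) :
    |havelockTrunc ν T x| ≤ Real.pi / 2 := by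
  rw [havelockTrunc_eq_integral_arctan]
  have h := intervalIntegral.norm_integral_le_of_norm_le_const (a := 0) (b := Real.arctan T)
    (f := fun θ => Real.sin (x * Real.tan θ - ν * θ)) (C := 1)
    fun θ _ => Real.abs_sin_le_one _
  rw [Real.norm_eq_abs, sub_zero, one_mul, abs_of_nonneg (Real.arctan_nonneg.2 hT)] at h
  exact h.trans (Real.arctan_lt_pi_div_two T).le

theorem continuous_havelock_integral (ν : ℝ) :
    Continuous fun x => ∫ θ in (0 : ℝ)..(Real.pi / 2), Real.sin (x * Real.tan θ - ν * θ) :=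
  intervalIntegral.continuous_of_dominated_interval (bound := fun _ => 1)
    (fun x => (measurable_havelock_integrand ν x).aestronglyMeasurable)
    (fun x => Eventually.of_forall fun θ _ => Real.abs_sin_le_one _) intervalIntegrable_const
    (Eventually.of_forall fun θ _ => by fun_prop)

/-- The oscillating part of the derivative of the truncated Havelock integral. -/
noncomputable def havelockOsc (ν T x : ℝ) : ℝ := Real.sin (havelockPhase ν x T) / (x * T)

theorem hasDerivAt_havelockOsc (ν : ℝ) {T x : ℝ} (hT : T ≠ 0) (hx : x ≠ 0) :
    HasDerivAt (havelockOsc ν T)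
      (Real.cos (havelockPhase ν x T) / x - Real.sin (havelockPhase ν x T) / (x ^ 2 * T)) x := by
  have h := ((hasDerivAt_havelockPhase_left ν x T).sin).div ((hasDerivAt_id x).mul_const T)
    (mul_ne_zero hx hT)
  convert! h using 1
  simp only [id]
  field_simp

theorem exists_hasDerivAt_havelock_integral (ν : ℝ) :
    ∃ L : ℝ, ∀ x, 0 < x → HasDerivAt
      (fun x => ∫ θ in (0 : ℝ)..(Real.pi / 2), Real.sin (x * Real.tan θ - ν * θ))
      (L + ∫ s in (1 : ℝ)..x,
        ((s - ν) * (∫ θ in (0 : ℝ)..(Real.pi / 2), Real.sin (s * Real.tan θ - ν * θ)) - 1) / s)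
      x := by
  have hT : ∀ n : ℕ, (0 : ℝ) < n + 1 := fun n => by positivity
  have hTlim : Tendsto (fun n : ℕ => (n + 1 : ℝ)) atTop atTop :=
    tendsto_atTop_add_const_right _ _ tendsto_natCast_atTop_atTop
  have hdecay : ∀ x c : ℝ, 0 < c → Tendsto
      (fun n : ℕ => Real.sin (havelockPhase ν x (n + 1)) / (c * (n + 1))) atTop (𝓝 0) := by
    intro x c hc
    have h1 : Tendsto (fun n : ℕ => 1 / (c * (n + 1 : ℝ))) atTop (𝓝 0) :=
      tendsto_const_nhds.div_atTop (hTlim.const_mul_atTop hc)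
    refine squeeze_zero_norm (fun n => ?_) h1
    have := hT n
    rw [Real.norm_eq_abs, abs_div, abs_of_pos (by positivity : 0 < c * (n + 1 : ℝ))]
    gcongr
    exact Real.abs_sin_le_one _
  have hbound : ∀ (x c : ℝ), 0 < c → ∀ n : ℕ,
      |Real.sin (havelockPhase ν x (n + 1)) / (c * (n + 1))| ≤ 1 / c := by
    intro x c hc n
    have := hT n
    rw [abs_div, abs_of_pos (by positivity : 0 < c * (n + 1 : ℝ))]
    gcongr
    · exact Real.abs_sin_le_one _
    · nlinarith [(Nat.cast_nonneg n : (0 : ℝ) ≤ n)]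
  have hphase : ∀ T, Continuous fun x => havelockPhase ν x T := fun T => by
    unfold havelockPhase
    fun_prop
  have htrunc : ∀ T, Continuous (havelockTrunc ν T) := fun T =>
    continuous_iff_continuousAt.2 fun x => (hasDerivAt_havelockTrunc ν T x).continuousAt
  refine exists_hasDerivAt_of_tendsto_of_second_deriv
    (f := fun n => havelockTrunc ν (n + 1))
    (M := fun n x => havelockTruncDeriv ν (n + 1) x - havelockOsc ν (n + 1) x)
    (e := fun n => havelockOsc ν (n + 1))
    (R := fun n x => ((x - ν) * havelockTrunc ν (n + 1) x - 1) / x +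
      Real.sin (havelockPhase ν x (n + 1)) / (x ^ 2 * (n + 1)))
    (B := fun x => ((x + |ν|) * (Real.pi / 2) + 1) / x + 1 / x ^ 2 + 1 / x)
    ?_ ?_ ?_ ?_ ?_ ?_ ?_ ?_ ?_ ?_ ?_
  · intro n x _
    simpa using hasDerivAt_havelockTrunc ν (n + 1) x
  · intro n x hx
    convert! (hasDerivAt_havelockTruncDeriv ν (n + 1) hx.ne').sub
      (hasDerivAt_havelockOsc ν (hT n).ne' hx.ne') using 1
    ring
  · intro n x hx
    exact (hasDerivAt_havelockOsc ν (hT n).ne' (ne_of_gt hx)).continuousAt.continuousWithinAt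
  · intro n
    refine ContinuousOn.add (ContinuousOn.div ?_ continuousOn_id fun x hx => ne_of_gt hx)
      (ContinuousOn.div ?_ ?_ fun x hx => ?_)
    · have := htrunc (n + 1)
      fun_prop
    · exact (Real.continuous_sin.comp (hphase _)).continuousOn
    · fun_prop
    · have hx' : (0 : ℝ) < x := hx
      have := hT n
      positivity
  · refine ContinuousOn.add (ContinuousOn.add (ContinuousOn.div (by fun_prop) continuousOn_id ?_)
      (ContinuousOn.div (by fun_prop) (by fun_prop) ?_))
      (ContinuousOn.div (by fun_prop) continuousOn_id ?_)
    · exact fun x hx => ne_of_gt hx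
    · exact fun x hx => pow_ne_zero 2 (ne_of_gt hx)
    · exact fun x hx => ne_of_gt hx
  · intro n x hx
    refine (hbound x x hx n).trans ?_
    have : 0 ≤ ((x + |ν|) * (Real.pi / 2) + 1) / x + 1 / x ^ 2 := by positivity
    linarith
  · intro n x hx
    have h1 : |((x - ν) * havelockTrunc ν (n + 1) x - 1) / x| ≤
        ((x + |ν|) * (Real.pi / 2) + 1) / x := by
      rw [abs_div, abs_of_pos hx]
      gcongr
      refine (abs_sub _ _).trans ?_
      rw [abs_mul, abs_one]
      gcongr
      · exact (abs_sub _ _).trans (by rw [abs_of_pos hx])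
      · exact abs_havelockTrunc_le ν x (hT n).le
    have h2 := hbound x (x ^ 2) (by positivity) n
    have h3 : 0 < 1 / x := by positivity
    refine (abs_add_le _ _).trans ?_
    linarith
  · intro x hx
    exact hdecay x x hx
  · intro x hx
    have h := (((tendsto_havelockTrunc ν x).comp hTlim).const_mul (x - ν)).sub_const 1
    simpa using! (h.div_const x).add (hdecay x (x ^ 2) (by positivity))
  · intro x _
    exact (tendsto_havelockTrunc ν x).comp hTlim
  · refine ContinuousOn.div ?_ continuousOn_id fun x hx => ne_of_gt hx
    have := continuous_havelock_integral ν
    fun_prop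

theorem havelock_ode (ν x : ℝ) (hx : 0 < x) :
    DifferentiableAt ℝ (havelockH ν) x ∧
    DifferentiableAt ℝ (deriv (havelockH ν)) x ∧
    x * deriv (deriv (havelockH ν)) x = (x - ν) * havelockH ν x - 2 / Real.pi := by
  obtain ⟨L, hL⟩ := exists_hasDerivAt_havelock_integral ν
  have hI := continuous_havelock_integral ν
  unfold havelockH
  set I : ℝ → ℝ := fun x =>
    ∫ θ in (0 : ℝ)..(Real.pi / 2), Real.sin (x * Real.tan θ - ν * θ)
  have hr : ContinuousOn (fun s => ((s - ν) * I s - 1) / s) (Ioi 0) :=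
    ContinuousOn.div (by fun_prop) continuousOn_id fun s hs => ne_of_gt hs
  have hd : ∀ y, 0 < y → HasDerivAt (fun x => 2 / Real.pi * I x)
      (2 / Real.pi * (L + ∫ s in (1 : ℝ)..y, ((s - ν) * I s - 1) / s)) y := fun y hy =>
    (hL y hy).const_mul _
  have hsub : uIcc 1 x ⊆ Ioi 0 := fun y hy => lt_of_lt_of_le (lt_min one_pos hx) hy.1
  have hprim : HasDerivAt (fun u => ∫ s in (1 : ℝ)..u, ((s - ν) * I s - 1) / s)
      (((x - ν) * I x - 1) / x) x :=
    intervalIntegral.integral_hasDerivAt_right (hr.mono hsub).intervalIntegrable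
      (hr.stronglyMeasurableAtFilter isOpen_Ioi x hx) (hr.continuousAt (Ioi_mem_nhds hx))
  have hdd : HasDerivAt (deriv fun x => 2 / Real.pi * I x)
      (2 / Real.pi * (((x - ν) * I x - 1) / x)) x :=
    ((hprim.const_add L).const_mul (2 / Real.pi)).congr_of_eventuallyEq
      (eventually_of_mem (Ioi_mem_nhds hx) fun y hy => (hd y hy).deriv)
  refine ⟨(hd x hx).differentiableAt, hdd.differentiableAt, ?_⟩
  change x * deriv (deriv fun x => 2 / Real.pi * I x) x = (x - ν) * (2 / Real.pi * I x) - _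
  rw [hdd.deriv]
  field_simp
end

section
/- For every real s > 0 with s ≠ 1, the Laplace transform of the Havelock function of order 0 is ∫₀^∞ e^{−s x} h_0(x) dx = 2 ln(s) / (π (s² − 1)). -/
open MeasureTheory Filter Topology in
theorem integral_exp_neg_mul_sin (s t : ℝ) (hs : 0 < s) :
    ∫ x in Set.Ioi (0 : ℝ), Real.exp (-s * x) * Real.sin (x * t) = t / (s ^ 2 + t ^ 2) := by
  have hD : s ^ 2 + t ^ 2 ≠ 0 := by positivity
  have hderiv (x : ℝ) : HasDerivAt
      (fun x => Real.exp (-s * x) * (-(s * Real.sin (x * t) + t * Real.cos (x * t))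
        / (s ^ 2 + t ^ 2)))
      (Real.exp (-s * x) * Real.sin (x * t)) x := by
    have h1 : HasDerivAt (fun x : ℝ => x * t) t x := by
      simpa using (hasDerivAt_id x).mul_const t
    have h2 : HasDerivAt (fun x : ℝ => -s * x) (-s) x := by
      simpa using (hasDerivAt_id x).const_mul (-s)
    have h3 := h2.exp.mul
      (((h1.sin.const_mul s).add (h1.cos.const_mul t)).neg.div_const (s ^ 2 + t ^ 2))
    refine h3.congr_deriv ?_
    simp only [Pi.add_apply, Pi.neg_apply]
    field_simp
    ring
  have hexp : IntegrableOn (fun x : ℝ => Real.exp (-s * x)) (Set.Ioi 0) :=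
    integrableOn_exp_mul_Ioi (neg_lt_zero.mpr hs) 0
  have hint : IntegrableOn (fun x : ℝ => Real.exp (-s * x) * Real.sin (x * t)) (Set.Ioi 0) := by
    refine hexp.mono' (by fun_prop) (ae_of_all _ fun x => ?_)
    rw [norm_mul, Real.norm_of_nonneg (Real.exp_pos _).le]
    exact mul_le_of_le_one_right (Real.exp_pos _).le (Real.abs_sin_le_one _)
  have hlim0 : Tendsto (fun x : ℝ => Real.exp (-s * x)) atTop (𝓝 0) :=
    Real.tendsto_exp_atBot.comp (tendsto_id.const_mul_atTop_of_neg (neg_lt_zero.mpr hs))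
  have hlim : Tendsto (fun x => Real.exp (-s * x) *
      (-(s * Real.sin (x * t) + t * Real.cos (x * t)) / (s ^ 2 + t ^ 2))) atTop (𝓝 0) := by
    refine hlim0.zero_mul_isBoundedUnder_le ⟨(s + |t|) / (s ^ 2 + t ^ 2), ?_⟩
    refine eventually_map.mpr (Eventually.of_forall fun x => ?_)
    simp only [Function.comp_apply, Real.norm_eq_abs, abs_div, abs_neg]
    rw [abs_of_pos (show 0 < s ^ 2 + t ^ 2 by positivity)]
    gcongr
    refine (abs_add_le _ _).trans ?_
    rw [abs_mul, abs_mul, abs_of_pos hs]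
    exact add_le_add (mul_le_of_le_one_right hs.le (Real.abs_sin_le_one _))
      (mul_le_of_le_one_right (abs_nonneg t) (Real.abs_cos_le_one _))
  rw [integral_Ioi_of_hasDerivAt_of_tendsto' (fun x _ => hderiv x) hint hlim]
  simp [neg_div]

theorem integral_tan_div_sq_add_tan_sq (s : ℝ) (hs : 0 < s) (hs1 : s ≠ 1) :
    ∫ θ in (0 : ℝ)..(Real.pi / 2), Real.tan θ / (s ^ 2 + Real.tan θ ^ 2) =
      Real.log s / (s ^ 2 - 1) := by
  have hne : s ^ 2 - 1 ≠ 0 := by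
    rw [sub_ne_zero]
    exact fun h => hs1 ((pow_eq_one_iff_of_nonneg hs.le two_ne_zero).mp h)
  have hD (θ : ℝ) : 0 < s ^ 2 * Real.cos θ ^ 2 + Real.sin θ ^ 2 := by
    by_cases hc : Real.cos θ = 0
    · have := Real.sin_sq_add_cos_sq θ
      rw [hc] at this ⊢
      nlinarith
    · positivity
  have heq (θ : ℝ) : Real.tan θ / (s ^ 2 + Real.tan θ ^ 2) =
      Real.sin θ * Real.cos θ / (s ^ 2 * Real.cos θ ^ 2 + Real.sin θ ^ 2) := by
    have := (hD θ).ne'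
    rw [Real.tan_eq_sin_div_cos]
    by_cases hc : Real.cos θ = 0
    · simp [hc]
    · field_simp
  have hderiv (θ : ℝ) : HasDerivAt
      (fun θ => -Real.log (s ^ 2 * Real.cos θ ^ 2 + Real.sin θ ^ 2) / (2 * (s ^ 2 - 1)))
      (Real.sin θ * Real.cos θ / (s ^ 2 * Real.cos θ ^ 2 + Real.sin θ ^ 2)) θ := by
    have h1 := (((Real.hasDerivAt_cos θ).pow 2).const_mul (s ^ 2)).add
      ((Real.hasDerivAt_sin θ).pow 2)
    have h2 := ((h1.log (hD θ).ne').neg).div_const (2 * (s ^ 2 - 1))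
    refine h2.congr_deriv ?_
    have := (hD θ).ne'
    simp only [Pi.add_apply, Pi.pow_apply]
    field_simp
    ring
  simp_rw [heq]
  rw [intervalIntegral.integral_eq_sub_of_hasDerivAt (fun θ _ => hderiv θ)
    (Continuous.intervalIntegrable
      (Continuous.div (by fun_prop) (by fun_prop) fun θ => (hD θ).ne') _ _)]
  simp only [Real.cos_pi_div_two, Real.sin_pi_div_two, Real.cos_zero, Real.sin_zero]
  norm_num
  field_simp

open MeasureTheory in
theorem integrable_exp_neg_mul_sin_mul_tan (s : ℝ) (hs : 0 < s) :
    Integrable (fun p : ℝ × ℝ => Real.exp (-s * p.1) * Real.sin (p.1 * Real.tan p.2))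
      ((volume.restrict (Set.Ioi (0 : ℝ))).prod
        (volume.restrict (Set.Ioc (0 : ℝ) (Real.pi / 2)))) := by
  have hexp : Integrable (fun x : ℝ => Real.exp (-s * x)) (volume.restrict (Set.Ioi 0)) :=
    integrableOn_exp_mul_Ioi (neg_lt_zero.mpr hs) 0
  have htan : Measurable Real.tan := by
    rw [show Real.tan = fun x => Real.sin x / Real.cos x from
      funext Real.tan_eq_sin_div_cos]
    fun_prop
  have hmeas : Measurable fun p : ℝ × ℝ =>
      Real.exp (-s * p.1) * Real.sin (p.1 * Real.tan p.2) := by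
    fun_prop
  refine (hexp.comp_fst (volume.restrict (Set.Ioc (0 : ℝ) (Real.pi / 2)))).mono'
    hmeas.aestronglyMeasurable (ae_of_all _ fun p => ?_)
  rw [norm_mul, Real.norm_of_nonneg (Real.exp_pos _).le]
  exact mul_le_of_le_one_right (Real.exp_pos _).le (Real.abs_sin_le_one _)

theorem havelock_zero_laplace (s : ℝ) (hs : 0 < s) (hs1 : s ≠ 1) :
    ∫ x in Set.Ioi (0 : ℝ), Real.exp (-s * x) * havelockH 0 x =
      2 * Real.log s / (Real.pi * (s ^ 2 - 1)) := by
  have hpi : (0 : ℝ) ≤ Real.pi / 2 := by positivity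
  have hH (x : ℝ) : Real.exp (-s * x) * havelockH 0 x = (2 / Real.pi) *
      ∫ θ in Set.Ioc (0 : ℝ) (Real.pi / 2),
        Real.exp (-s * x) * Real.sin (x * Real.tan θ) := by
    rw [MeasureTheory.integral_const_mul, havelockH, intervalIntegral.integral_of_le hpi]
    simp only [zero_mul, sub_zero]
    ring
  simp_rw [hH]
  rw [MeasureTheory.integral_const_mul,
    MeasureTheory.integral_integral_swap (integrable_exp_neg_mul_sin_mul_tan s hs)]
  simp_rw [integral_exp_neg_mul_sin s _ hs]
  rw [← intervalIntegral.integral_of_le hpi, integral_tan_div_sq_add_tan_sq s hs hs1,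
    div_mul_div_comm]
end

section
/- For every real s > 0, the Laplace transform of the Havelock function of order 2 is ∫₀^∞ e^{−s x} h_2(x) dx = −2 (s + 1 + ln(s)) / (π (s + 1)²). -/
open MeasureTheory Filter Topology in
/-- The Laplace transform of a phase-shifted sine. -/
theorem integral_exp_neg_mul_sin_sub {s : ℝ} (hs : 0 < s) (t φ : ℝ) :
    ∫ x in Set.Ioi (0 : ℝ), Real.exp (-s * x) * Real.sin (x * t - φ) =
      (t * Real.cos φ - s * Real.sin φ) / (s ^ 2 + t ^ 2) := by
  have hd : s ^ 2 + t ^ 2 ≠ 0 := by positivity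
  have hexp : IntegrableOn (fun x : ℝ => Real.exp (-s * x)) (Set.Ioi 0) :=
    integrableOn_exp_mul_Ioi (by linarith) 0
  have hderiv (x : ℝ) : HasDerivAt (fun x : ℝ => Real.exp (-s * x) *
      (-(s * Real.sin (x * t - φ) + t * Real.cos (x * t - φ)) / (s ^ 2 + t ^ 2)))
      (Real.exp (-s * x) * Real.sin (x * t - φ)) x := by
    have h1 : HasDerivAt (fun x : ℝ => x * t - φ) t x := by
      simpa using ((hasDerivAt_id x).mul_const t).sub_const φ
    have h2 : HasDerivAt (fun x : ℝ => -s * x) (-s) x := by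
      simpa using (hasDerivAt_id x).const_mul (-s)
    refine (h2.exp.fun_mul (((h1.sin.const_mul s).fun_add
      (h1.cos.const_mul t)).fun_neg.div_const (s ^ 2 + t ^ 2))).congr_deriv ?_
    field_simp
    ring
  have hint : IntegrableOn (fun x : ℝ => Real.exp (-s * x) * Real.sin (x * t - φ))
      (Set.Ioi 0) := by
    refine Integrable.mono' hexp (by fun_prop) (ae_of_all _ fun x => ?_)
    rw [norm_mul, Real.norm_eq_abs, Real.abs_exp]
    exact mul_le_of_le_one_right (Real.exp_pos _).le (Real.abs_sin_le_one _)
  have hlim : Tendsto (fun x : ℝ => Real.exp (-s * x) *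
      (-(s * Real.sin (x * t - φ) + t * Real.cos (x * t - φ)) / (s ^ 2 + t ^ 2)))
      atTop (𝓝 0) := by
    have h0 : Tendsto (fun x : ℝ => Real.exp (-s * x)) atTop (𝓝 0) :=
      Real.tendsto_exp_atBot.comp (tendsto_id.const_mul_atTop_of_neg (by linarith))
    refine h0.zero_mul_isBoundedUnder_le ⟨(s + |t|) / (s ^ 2 + t ^ 2), ?_⟩
    have hp : 0 < s ^ 2 + t ^ 2 := by positivity
    refine eventually_map.2 (Eventually.of_forall fun x => ?_)
    rw [Function.comp_apply, norm_div, norm_neg, Real.norm_eq_abs, Real.norm_eq_abs,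
      abs_of_pos hp]
    gcongr
    refine (abs_add_le _ _).trans ?_
    rw [abs_mul, abs_mul, abs_of_pos hs]
    exact add_le_add (mul_le_of_le_one_right hs.le (Real.abs_sin_le_one _))
      (mul_le_of_le_one_right (abs_nonneg t) (Real.abs_cos_le_one _))
  rw [integral_Ioi_of_hasDerivAt_of_tendsto' (fun x _ => hderiv x) hint hlim]
  simp
  ring

theorem integral_tan_mul_cos_two_mul_sub {s : ℝ} (hs : 0 < s) :
    ∫ θ in (0 : ℝ)..(Real.pi / 2),
      (Real.tan θ * Real.cos (2 * θ) - s * Real.sin (2 * θ)) / (s ^ 2 + Real.tan θ ^ 2) =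
      -(s + 1 + Real.log s) / (s + 1) ^ 2 := by
  have hD (θ : ℝ) : 0 < Real.sin θ ^ 2 + s ^ 2 * Real.cos θ ^ 2 := by
    by_cases h : Real.cos θ = 0
    · have := Real.sin_sq_add_cos_sq θ
      simp only [h] at this ⊢
      linarith
    · positivity
  have heq (θ : ℝ) :
      (Real.tan θ * Real.cos (2 * θ) - s * Real.sin (2 * θ)) / (s ^ 2 + Real.tan θ ^ 2) =
      Real.sin θ * Real.cos θ * (2 * Real.cos θ ^ 2 - 1 - 2 * s * Real.cos θ ^ 2) /
        (Real.sin θ ^ 2 + s ^ 2 * Real.cos θ ^ 2) := by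
    rw [Real.cos_two_mul, Real.sin_two_mul, Real.tan_eq_sin_div_cos]
    by_cases h : Real.cos θ = 0
    · simp [h]
    · have h1 := (hD θ).ne'
      have h2 : s ^ 2 + (Real.sin θ / Real.cos θ) ^ 2 ≠ 0 := by positivity
      rw [div_eq_div_iff h2 h1]
      field_simp
      ring
  have hderiv (θ : ℝ) : HasDerivAt (fun θ => Real.cos θ ^ 2 / (s + 1) +
      Real.log (Real.sin θ ^ 2 + s ^ 2 * Real.cos θ ^ 2) / (2 * (s + 1) ^ 2))
      (Real.sin θ * Real.cos θ * (2 * Real.cos θ ^ 2 - 1 - 2 * s * Real.cos θ ^ 2) /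
        (Real.sin θ ^ 2 + s ^ 2 * Real.cos θ ^ 2)) θ := by
    have hc := (Real.hasDerivAt_cos θ).fun_pow 2
    have hl := (((Real.hasDerivAt_sin θ).fun_pow 2).fun_add (hc.const_mul (s ^ 2))).log (hD θ).ne'
    refine ((hc.div_const (s + 1)).fun_add (hl.div_const (2 * (s + 1) ^ 2))).congr_deriv ?_
    have h1 := (hD θ).ne'
    have h2 : s + 1 ≠ 0 := by positivity
    rw [Real.sin_sq] at h1 ⊢
    field_simp
    ring
  simp_rw [heq]
  rw [intervalIntegral.integral_eq_sub_of_hasDerivAt (fun θ _ => hderiv θ)]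
  · have h2 : s + 1 ≠ 0 := by positivity
    simp [Real.log_pow]
    field_simp
    ring
  · exact (Continuous.div (by fun_prop) (by fun_prop)
      fun θ => (hD θ).ne').intervalIntegrable _ _

open MeasureTheory in
theorem integrable_exp_neg_mul_sin_tan_sub {s : ℝ} (hs : 0 < s) (ν : ℝ) :
    Integrable (Function.uncurry fun x θ : ℝ =>
      Real.exp (-s * x) * Real.sin (x * Real.tan θ - ν * θ))
      ((volume.restrict (Set.Ioi 0)).prod (volume.restrict (Set.Ioc 0 (Real.pi / 2)))) := by
  have htan : Measurable Real.tan := by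
    simp_rw [funext Real.tan_eq_sin_div_cos]
    fun_prop
  have hexp : IntegrableOn (fun x : ℝ => Real.exp (-s * x)) (Set.Ioi 0) :=
    integrableOn_exp_mul_Ioi (by linarith) 0
  refine Integrable.mono' (hexp.integrable.mul_prod (integrable_const (1 : ℝ))) ?_
    (ae_of_all _ fun z => ?_)
  · refine Measurable.aestronglyMeasurable ?_
    simp only [Function.uncurry_def]
    fun_prop
  · simp only [Function.uncurry_def, norm_mul, Real.norm_eq_abs, Real.abs_exp]
    exact mul_le_mul_of_nonneg_left (Real.abs_sin_le_one _) (Real.exp_pos _).le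

theorem havelock_two_laplace (s : ℝ) (hs : 0 < s) :
    ∫ x in Set.Ioi (0 : ℝ), Real.exp (-s * x) * havelockH 2 x =
      -(2 * (s + 1 + Real.log s)) / (Real.pi * (s + 1) ^ 2) := by
  have hpi : (0 : ℝ) ≤ Real.pi / 2 := by positivity
  have hH (x : ℝ) : Real.exp (-s * x) * havelockH 2 x = 2 / Real.pi *
      ∫ θ in Set.Ioc 0 (Real.pi / 2),
        Real.exp (-s * x) * Real.sin (x * Real.tan θ - 2 * θ) := by
    rw [havelockH, intervalIntegral.integral_of_le hpi, MeasureTheory.integral_const_mul]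
    ring
  simp_rw [hH]
  rw [MeasureTheory.integral_const_mul,
    MeasureTheory.integral_integral_swap (integrable_exp_neg_mul_sin_tan_sub hs 2)]
  simp_rw [integral_exp_neg_mul_sin_sub hs]
  rw [← intervalIntegral.integral_of_le hpi, integral_tan_mul_cos_two_mul_sub hs,
    div_mul_div_comm]
  ring
end

section
/- For every x > 0 the following three trigonometric integrals have the stated closed forms: ∫₀^{π/2} (cos θ)² cos(x·tan θ) dθ = π(1 + x) e^{−x}/4; ∫₀^{π/2} (sin θ)² cos(x·tan θ) dθ = π(1 − x) e^{−x}/4; and ∫₀^{π/2} cos θ · sin θ · sin(x·tan θ) dθ = π x e^{−x}/4. -/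
open Real MeasureTheory Filter Topology

lemma ae_cos_ne_zero_of_mem_uIoc :
    ∀ᵐ θ : ℝ, θ ∈ Set.uIoc 0 (π / 2) → cos θ ≠ 0 := by
  filter_upwards [Measure.ae_ne volume (π / 2)] with θ hne hθ
  rw [Set.uIoc_of_le (by positivity)] at hθ
  exact (cos_pos_of_mem_Ioo ⟨by linarith [hθ.1, pi_pos], lt_of_le_of_ne hθ.2 hne⟩).ne'

lemma measurable_real_tan : Measurable tan := by
  simp only [funext tan_eq_sin_div_cos]
  fun_prop

lemma intervalIntegrable_of_measurable_of_abs_le_one {f : ℝ → ℝ} (hf : Measurable f)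
    (hb : ∀ θ, |f θ| ≤ 1) (a b : ℝ) : IntervalIntegrable f volume a b :=
  (intervalIntegrable_const (c := (1 : ℝ))).mono_fun hf.aestronglyMeasurable
    (Eventually.of_forall fun θ => by simpa using hb θ)

lemma abs_intervalIntegral_le_of_abs_le_one {f : ℝ → ℝ} (hb : ∀ θ, |f θ| ≤ 1) (a b : ℝ) :
    |∫ θ in a..b, f θ| ≤ |b - a| := by
  simpa using intervalIntegral.norm_integral_le_of_norm_le_const (f := f) (C := 1) (a := a) (b := b)
    fun θ _ => hb θ

lemma abs_mul_le_one {a b : ℝ} (ha : |a| ≤ 1) (hb : |b| ≤ 1) : |a * b| ≤ 1 := by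
  rw [abs_mul]
  exact mul_le_one₀ ha (abs_nonneg b) hb

lemma abs_cos_sq_mul_cos_le (x θ : ℝ) : |cos θ ^ 2 * cos (x * tan θ)| ≤ 1 :=
  abs_mul_le_one (by rw [sq]; exact abs_mul_le_one (abs_cos_le_one _) (abs_cos_le_one _))
    (abs_cos_le_one _)

lemma abs_sin_sq_mul_cos_le (x θ : ℝ) : |sin θ ^ 2 * cos (x * tan θ)| ≤ 1 :=
  abs_mul_le_one (by rw [sq]; exact abs_mul_le_one (abs_sin_le_one _) (abs_sin_le_one _))
    (abs_cos_le_one _)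

lemma abs_cos_mul_sin_mul_sin_le (x θ : ℝ) : |cos θ * sin θ * sin (x * tan θ)| ≤ 1 :=
  abs_mul_le_one (abs_mul_le_one (abs_cos_le_one _) (abs_sin_le_one _)) (abs_sin_le_one _)

lemma measurable_cos_sq_mul_cos (x : ℝ) : Measurable fun θ => cos θ ^ 2 * cos (x * tan θ) := by
  have := measurable_real_tan
  fun_prop

lemma measurable_sin_sq_mul_cos (x : ℝ) : Measurable fun θ => sin θ ^ 2 * cos (x * tan θ) := by
  have := measurable_real_tan
  fun_prop

lemma measurable_cos_mul_sin_mul_sin (x : ℝ) :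
    Measurable fun θ => cos θ * sin θ * sin (x * tan θ) := by
  have := measurable_real_tan
  fun_prop

lemma hasDerivAt_integral_cos_sq_mul_cos (x : ℝ) :
    HasDerivAt (fun y => ∫ θ in (0 : ℝ)..(π / 2), cos θ ^ 2 * cos (y * tan θ))
      (-∫ θ in (0 : ℝ)..(π / 2), cos θ * sin θ * sin (x * tan θ)) x := by
  rw [← intervalIntegral.integral_neg]
  refine (intervalIntegral.hasDerivAt_integral_of_dominated_loc_of_deriv_le
    (F' := fun y θ => -(cos θ * sin θ * sin (y * tan θ))) (bound := fun _ => 1) univ_mem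
    (Eventually.of_forall fun y => (measurable_cos_sq_mul_cos y).aestronglyMeasurable)
    (intervalIntegrable_of_measurable_of_abs_le_one (measurable_cos_sq_mul_cos x)
      (abs_cos_sq_mul_cos_le x) _ _)
    (measurable_cos_mul_sin_mul_sin x).neg.aestronglyMeasurable
    (Eventually.of_forall fun θ _ y _ => ?_) intervalIntegrable_const ?_).2
  · simpa using abs_cos_mul_sin_mul_sin_le y θ
  · filter_upwards [ae_cos_ne_zero_of_mem_uIoc] with θ h hθ y _
    have hc := h hθ
    refine (((hasDerivAt_id y).mul_const (tan θ)).cos.const_mul (cos θ ^ 2)).congr_deriv ?_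
    rw [tan_eq_sin_div_cos]
    simp only [id]
    field_simp

lemma hasDerivAt_integral_cos_mul_sin_mul_sin (x : ℝ) :
    HasDerivAt (fun y => ∫ θ in (0 : ℝ)..(π / 2), cos θ * sin θ * sin (y * tan θ))
      (∫ θ in (0 : ℝ)..(π / 2), sin θ ^ 2 * cos (x * tan θ)) x := by
  refine (intervalIntegral.hasDerivAt_integral_of_dominated_loc_of_deriv_le
    (F' := fun y θ => sin θ ^ 2 * cos (y * tan θ)) (bound := fun _ => 1) univ_mem
    (Eventually.of_forall fun y => (measurable_cos_mul_sin_mul_sin y).aestronglyMeasurable)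
    (intervalIntegrable_of_measurable_of_abs_le_one (measurable_cos_mul_sin_mul_sin x)
      (abs_cos_mul_sin_mul_sin_le x) _ _)
    (measurable_sin_sq_mul_cos x).aestronglyMeasurable
    (Eventually.of_forall fun θ _ y _ => ?_) intervalIntegrable_const ?_).2
  · simpa using abs_sin_sq_mul_cos_le y θ
  · filter_upwards [ae_cos_ne_zero_of_mem_uIoc] with θ h hθ y _
    have hc := h hθ
    refine (((hasDerivAt_id y).mul_const (tan θ)).sin.const_mul (cos θ * sin θ)).congr_deriv ?_
    rw [tan_eq_sin_div_cos]
    simp only [id]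
    field_simp

lemma continuous_cos_sq_mul_sin (x : ℝ) : Continuous fun θ => cos θ ^ 2 * sin (x * tan θ) := by
  rw [continuous_iff_continuousAt]
  intro θ
  by_cases hc : cos θ = 0
  · have h0 : Tendsto (fun θ => cos θ ^ 2) (𝓝 θ) (𝓝 0) := by
      have : ContinuousAt (fun θ => cos θ ^ 2) θ := by fun_prop
      simpa [ContinuousAt, hc] using this
    rw [ContinuousAt, hc, zero_pow two_ne_zero, zero_mul]
    refine squeeze_zero_norm (fun t => ?_) h0
    rw [norm_mul, norm_of_nonneg (sq_nonneg (cos t))]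
    exact mul_le_of_le_one_right (sq_nonneg _) (abs_sin_le_one _)
  · have := continuousAt_tan.2 hc
    fun_prop

lemma two_mul_integral_cos_mul_sin_mul_sin (x : ℝ) :
    2 * ∫ θ in (0 : ℝ)..(π / 2), cos θ * sin θ * sin (x * tan θ) =
      x * ((∫ θ in (0 : ℝ)..(π / 2), cos θ ^ 2 * cos (x * tan θ)) +
        ∫ θ in (0 : ℝ)..(π / 2), sin θ ^ 2 * cos (x * tan θ)) := by
  have hA := intervalIntegrable_of_measurable_of_abs_le_one (measurable_cos_sq_mul_cos x)
    (abs_cos_sq_mul_cos_le x) 0 (π / 2)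
  have hB := intervalIntegrable_of_measurable_of_abs_le_one (measurable_sin_sq_mul_cos x)
    (abs_sin_sq_mul_cos_le x) 0 (π / 2)
  have hC := intervalIntegrable_of_measurable_of_abs_le_one (measurable_cos_mul_sin_mul_sin x)
    (abs_cos_mul_sin_mul_sin_le x) 0 (π / 2)
  have key := intervalIntegral.integral_eq_sub_of_hasDerivAt_of_le (a := 0) (b := π / 2)
    (by positivity) (continuous_cos_sq_mul_sin x).continuousOn
    (f' := fun θ => x * (cos θ ^ 2 * cos (x * tan θ) + sin θ ^ 2 * cos (x * tan θ)) -
      2 * (cos θ * sin θ * sin (x * tan θ))) (fun θ hθ => ?_)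
    (((hA.add hB).const_mul x).sub (hC.const_mul 2))
  · rw [intervalIntegral.integral_sub ((hA.add hB).const_mul x) (hC.const_mul 2),
      intervalIntegral.integral_const_mul, intervalIntegral.integral_const_mul,
      intervalIntegral.integral_add hA hB] at key
    simp only [cos_pi_div_two, tan_zero, mul_zero, sin_zero] at key
    linarith
  · have hc : cos θ ≠ 0 := (cos_pos_of_mem_Ioo ⟨by linarith [hθ.1, pi_pos], hθ.2⟩).ne'
    refine (((hasDerivAt_cos θ).pow 2).mul ((hasDerivAt_tan hc).const_mul x).sin).congr_deriv ?_
    simp only [Pi.pow_apply]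
    field_simp
    linear_combination (-x * cos (x * tan θ)) * sin_sq_add_cos_sq θ

lemma eq_of_bounded_of_hasDerivAt {A C : ℝ → ℝ} {M : ℝ} (hA : ∀ x, HasDerivAt A (-C x) x)
    (hC : ∀ x, 0 < x → HasDerivAt C (2 * C x / x - A x) x) (hAM : ∀ x, |A x| ≤ M)
    (hCM : ∀ x, |C x| ≤ M) {x : ℝ} (hx : 0 < x) :
    A x = A 0 * (1 + x) * exp (-x) ∧ C x = A 0 * x * exp (-x) := by
  have const : ∀ f : ℝ → ℝ, (∀ y, 0 < y → HasDerivAt f 0 y) → ∃ k, ∀ y, 0 < y → f y = k :=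
    fun f hf => isOpen_Ioi.exists_is_const_of_deriv_eq_zero isPreconnected_Ioi
      (fun y hy => (hf y hy).differentiableAt.differentiableWithinAt) fun y hy => (hf y hy).deriv
  have hE : ∀ y, HasDerivAt (fun y => exp (-y)) (-exp (-y)) y := fun y =>
    (hasDerivAt_neg y).exp.congr_deriv (by ring)
  obtain ⟨a, ha⟩ := const (fun y => exp y * (C y / y + (A y - C y / y) / y)) fun y hy => by
    have hq := (hC y hy).div (hasDerivAt_id y) hy.ne'
    refine ((hasDerivAt_exp y).mul (hq.add (((hA y).sub hq).div (hasDerivAt_id y)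
      hy.ne'))).congr_deriv ?_
    simp only [Pi.add_apply, Pi.div_apply, Pi.sub_apply, id]
    field_simp
    ring
  obtain ⟨b, hb⟩ := const (fun y => exp (-y) * (C y / y - (A y - C y / y) / y)) fun y hy => by
    have hq := (hC y hy).div (hasDerivAt_id y) hy.ne'
    refine ((hE y).mul (hq.sub (((hA y).sub hq).div (hasDerivAt_id y) hy.ne'))).congr_deriv ?_
    simp only [Pi.div_apply, Pi.sub_apply, id]
    field_simp
    ring
  have hb0 : b = 0 := by
    have h0 : Tendsto (fun y : ℝ => exp (-y) * (3 * M)) atTop (𝓝 0) := by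
      simpa using tendsto_exp_neg_atTop_nhds_zero.mul_const (3 * M)
    refine tendsto_nhds_unique tendsto_const_nhds
      (squeeze_zero_norm' ((eventually_ge_atTop 1).mono fun y hy => ?_) h0)
    have hdiv : ∀ {u K : ℝ}, |u| ≤ K → |u / y| ≤ K := fun {u K} h => by
      rw [abs_div]
      exact (div_le_self (abs_nonneg u) (hy.trans (le_abs_self y))).trans h
    rw [← hb y (by linarith), norm_mul, norm_of_nonneg (exp_pos _).le]
    gcongr
    have h1 := hdiv (hCM y)
    have h2 := hdiv ((abs_sub (A y) (C y / y)).trans (add_le_add (hAM y) h1))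
    rw [norm_eq_abs]
    exact (abs_sub _ _).trans (by linarith)
  have key : ∀ y, 0 < y → C y = a / 2 * y * exp (-y) ∧ A y = a / 2 * (1 + y) * exp (-y) := by
    intro y hy
    have h1 := ha y hy
    have h2 := hb y hy
    have h3 : C y / y = (A y - C y / y) / y := by
      rw [hb0, mul_eq_zero, or_iff_right (exp_pos _).ne', sub_eq_zero] at h2
      exact h2
    have h4 : C y / y = a / 2 * exp (-y) := by
      rw [← h1, ← h3, exp_neg]
      field_simp
      ring
    have h5 : C y = a / 2 * y * exp (-y) := by
      rw [div_eq_iff hy.ne'] at h4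
      linarith
    refine ⟨h5, ?_⟩
    rw [h4, eq_div_iff hy.ne'] at h3
    linarith
  have ha0 : A 0 = a / 2 := by
    have h1 : Tendsto A (𝓝[>] 0) (𝓝 (A 0)) := (hA 0).continuousAt.mono_left nhdsWithin_le_nhds
    have h2 : Tendsto (fun y => a / 2 * (1 + y) * exp (-y)) (𝓝[>] 0) (𝓝 (a / 2)) := by
      have : Continuous fun y => a / 2 * (1 + y) * exp (-y) := by fun_prop
      simpa using (this.tendsto 0).mono_left (nhdsWithin_le_nhds (s := Set.Ioi 0))
    refine tendsto_nhds_unique h1 (h2.congr' ?_)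
    filter_upwards [self_mem_nhdsWithin] with y hy using (key y hy).2.symm
  rw [ha0]
  exact (key x hx).symm

theorem generalized_bateman_integrals (x : ℝ) (hx : 0 < x) :
    (∫ θ in (0:ℝ)..(Real.pi / 2), (Real.cos θ) ^ 2 * Real.cos (x * Real.tan θ) =
      Real.pi * (1 + x) * Real.exp (-x) / 4) ∧
    (∫ θ in (0:ℝ)..(Real.pi / 2), (Real.sin θ) ^ 2 * Real.cos (x * Real.tan θ) =
      Real.pi * (1 - x) * Real.exp (-x) / 4) ∧
    (∫ θ in (0:ℝ)..(Real.pi / 2), Real.cos θ * Real.sin θ * Real.sin (x * Real.tan θ) =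
      Real.pi * x * Real.exp (-x) / 4) := by
  have hsum := two_mul_integral_cos_mul_sin_mul_sin
  obtain ⟨h1, h2⟩ := eq_of_bounded_of_hasDerivAt (M := |π / 2 - 0|)
    hasDerivAt_integral_cos_sq_mul_cos
    (fun y hy => (hasDerivAt_integral_cos_mul_sin_mul_sin y).congr_deriv (by
      rw [hsum y]
      field_simp
      ring))
    (fun y => abs_intervalIntegral_le_of_abs_le_one (abs_cos_sq_mul_cos_le y) _ _)
    (fun y => abs_intervalIntegral_le_of_abs_le_one (abs_cos_mul_sin_mul_sin_le y) _ _) hx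
  have h0 : ∫ θ in (0 : ℝ)..(π / 2), cos θ ^ 2 * cos (0 * tan θ) = π / 4 := by
    simp only [zero_mul, cos_zero, mul_one, integral_cos_sq, cos_pi_div_two, sin_zero]
    ring
  rw [h0] at h1 h2
  have h3 := hsum x
  rw [h1, h2] at h3
  refine ⟨by rw [h1]; ring, mul_left_cancel₀ hx.ne' ?_, by rw [h2]; ring⟩
  linear_combination -h3
end

section
/- For every integer n ≥ 0 and every x > 0, the Bateman-integral function is expressed through the Bateman and Havelock functions of order 2n by the Wronskian-type formula ki_{2n}(x) = (π/2) (k_{2n}'(x) h_{2n}(x) − h_{2n}'(x) k_{2n}(x)), where k_{2n} and h_{2n} are differentiable at x. -/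
/-- The Bateman function `k_ν(x) = (2/π) ∫₀^{π/2} cos(x·tan θ − ν·θ) dθ`. -/
noncomputable def batemanK (ν x : ℝ) : ℝ :=
  (2 / Real.pi) * ∫ θ in (0:ℝ)..(Real.pi / 2), Real.cos (x * Real.tan θ - ν * θ)

/-- The Bateman-integral function `ki_{2n}(x) = -∫ₓ^∞ k_{2n}(t)/t dt`. -/
noncomputable def batemanKi (n : ℕ) (x : ℝ) : ℝ :=
  -∫ t in Set.Ioi x, batemanK (2 * n) t / t

open Complex Set Filter Topology MeasureTheory

/-- The phase factor `exp (i (x tan θ - ν θ))`. -/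
noncomputable def batemanPhase (ν x θ : ℝ) : ℂ :=
  cexp (((x * Real.tan θ - ν * θ : ℝ) : ℂ) * I)

/-- The integral of the phase factor, equal to `(π / 2) (k_ν(x) + i h_ν(x))`. -/
noncomputable def batemanE (ν x : ℝ) : ℂ :=
  ∫ θ in (0:ℝ)..(Real.pi / 2), batemanPhase ν x θ

lemma norm_batemanPhase (ν x θ : ℝ) : ‖batemanPhase ν x θ‖ = 1 :=
  norm_exp_ofReal_mul_I _

lemma measurable_batemanPhase (ν x : ℝ) : Measurable (batemanPhase ν x) := by
  unfold batemanPhase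
  simp_rw [Real.tan_eq_sin_div_cos]
  fun_prop

lemma intervalIntegrable_batemanPhase (ν x a b : ℝ) :
    IntervalIntegrable (batemanPhase ν x) volume a b :=
  (intervalIntegrable_const (c := (1 : ℝ))).mono_fun
    (measurable_batemanPhase ν x).aestronglyMeasurable
    (Eventually.of_forall fun θ => by simp [norm_batemanPhase])

lemma norm_batemanE_le (ν x : ℝ) : ‖batemanE ν x‖ ≤ Real.pi / 2 := by
  have h := intervalIntegral.norm_integral_le_of_norm_le_const (a := 0) (b := Real.pi / 2)
    (f := batemanPhase ν x) (C := 1) fun θ _ => (norm_batemanPhase ν x θ).le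
  rwa [one_mul, sub_zero, abs_of_pos (by positivity)] at h

lemma batemanPhase_add_two (ν x θ : ℝ) :
    batemanPhase (ν + 2) x θ = batemanPhase ν x θ * (Real.cos θ - Real.sin θ * I) ^ 2 := by
  have h : ((Real.cos θ : ℂ) - Real.sin θ * I) = cexp (-θ * I) := by
    rw [exp_mul_I]; simp [sub_eq_add_neg]
  rw [h, ← exp_nat_mul, batemanPhase, batemanPhase, ← Complex.exp_add]
  congr 1
  push_cast
  ring

lemma batemanPhase_sub_two (ν x θ : ℝ) :
    batemanPhase (ν - 2) x θ = batemanPhase ν x θ * (Real.cos θ + Real.sin θ * I) ^ 2 := by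
  have h : ((Real.cos θ : ℂ) + Real.sin θ * I) = cexp (θ * I) := by
    rw [exp_mul_I]; simp
  rw [h, ← exp_nat_mul, batemanPhase, batemanPhase, ← Complex.exp_add]
  congr 1
  push_cast
  ring

lemma ofReal_cos_sq_add_sin_sq (θ : ℝ) : (Real.cos θ : ℂ) ^ 2 + (Real.sin θ : ℂ) ^ 2 = 1 := by
  exact_mod_cast Real.cos_sq_add_sin_sq θ

lemma tan_mul_batemanPhase_add (ν x θ : ℝ) (hθ : Real.cos θ ≠ 0) :
    (Real.tan θ : ℂ) * I * (batemanPhase ν x θ + batemanPhase (ν + 2) x θ) =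
      batemanPhase ν x θ - batemanPhase (ν + 2) x θ := by
  have h := ofReal_cos_sq_add_sin_sq θ
  have hc : (Real.cos θ : ℂ) ≠ 0 := by exact_mod_cast hθ
  rw [batemanPhase_add_two, Real.tan_eq_sin_div_cos, ofReal_div]
  generalize (Real.cos θ : ℂ) = c at *
  generalize (Real.sin θ : ℂ) = s at *
  field_simp
  linear_combination batemanPhase ν x θ * (c - s * I) * h +
    batemanPhase ν x θ * (s ^ 3 * I - c * s ^ 2) * I_sq

lemma hasDerivAt_batemanPhase_left (ν x θ : ℝ) :
    HasDerivAt (fun y => batemanPhase ν y θ) (Real.tan θ * I * batemanPhase ν x θ) x := by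
  have h : HasDerivAt (fun y : ℝ => y * Real.tan θ - ν * θ) (Real.tan θ) x := by
    simpa using ((hasDerivAt_id x).mul_const (Real.tan θ)).sub_const (ν * θ)
  exact (h.ofReal_comp.mul_const I).cexp.congr_deriv (mul_comm _ _)

lemma cos_ne_zero_of_mem_Ioo {θ : ℝ} (h : θ ∈ Ioo 0 (Real.pi / 2)) : Real.cos θ ≠ 0 :=
  (Real.cos_pos_of_mem_Ioo ⟨by linarith [h.1, Real.pi_pos], h.2⟩).ne'

lemma hasDerivAt_batemanE_add (ν x : ℝ) :
    HasDerivAt (fun y => batemanE ν y + batemanE (ν + 2) y)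
      (batemanE ν x - batemanE (ν + 2) x) x := by
  have hi := intervalIntegrable_batemanPhase
  have key := (intervalIntegral.hasDerivAt_integral_of_dominated_loc_of_deriv_le
    (μ := volume) (a := 0) (b := Real.pi / 2) (x₀ := x) (s := univ) (bound := fun _ => 2)
    (F := fun y θ => batemanPhase ν y θ + batemanPhase (ν + 2) y θ)
    (F' := fun y θ => batemanPhase ν y θ - batemanPhase (ν + 2) y θ)
    univ_mem
    (Eventually.of_forall fun y =>
      ((measurable_batemanPhase ν y).add
        (measurable_batemanPhase (ν + 2) y)).aestronglyMeasurable)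
    ((hi _ _ _ _).add (hi _ _ _ _))
    ((measurable_batemanPhase ν x).sub
        (measurable_batemanPhase (ν + 2) x)).aestronglyMeasurable
    (Eventually.of_forall fun θ _ y _ => by
      refine (norm_sub_le _ _).trans ?_
      rw [norm_batemanPhase, norm_batemanPhase]
      norm_num)
    intervalIntegrable_const
    (by
      filter_upwards [Measure.ae_ne volume (Real.pi / 2)] with θ hne hθ y _
      rw [uIoc_of_le (by positivity)] at hθ
      rw [← tan_mul_batemanPhase_add ν y θ
        (cos_ne_zero_of_mem_Ioo ⟨hθ.1, lt_of_le_of_ne hθ.2 hne⟩), mul_add]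
      exact (hasDerivAt_batemanPhase_left ν y θ).add
        (hasDerivAt_batemanPhase_left (ν + 2) y θ))).2
  simp only [batemanE]
  rw [← intervalIntegral.integral_sub (hi _ _ _ _) (hi _ _ _ _)]
  simp_rw [← intervalIntegral.integral_add (hi _ _ _ _) (hi _ _ _ _)]
  exact key

lemma hasDerivAt_cos_sq_mul_batemanPhase (ν x θ : ℝ) (hθ : Real.cos θ ≠ 0) :
    HasDerivAt (fun φ => ((Real.cos φ : ℂ)) ^ 2 * batemanPhase ν x φ)
      (I * ((x - ν / 2) * batemanPhase ν x θ - (ν + 2) / 4 * batemanPhase (ν + 2) x θ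
        - (ν - 2) / 4 * batemanPhase (ν - 2) x θ)) θ := by
  have hc : (Real.cos θ : ℂ) ≠ 0 := by exact_mod_cast hθ
  have h1 := ((Real.hasDerivAt_cos θ).ofReal_comp).pow 2
  have h2 : HasDerivAt (batemanPhase ν x) _ θ :=
    ((((Real.hasDerivAt_tan hθ).const_mul x).sub
      ((hasDerivAt_id θ).const_mul ν)).ofReal_comp.mul_const I).cexp
  refine (h1.mul h2).congr_deriv ?_
  have h := ofReal_cos_sq_add_sin_sq θ
  change _ + _ * (batemanPhase ν x θ * _) = _
  rw [batemanPhase_add_two, batemanPhase_sub_two]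
  simp only [Pi.pow_apply, Nat.cast_ofNat, Nat.add_one_sub_one, pow_one]
  push_cast at h hc ⊢
  generalize cos (θ : ℂ) = c at *
  generalize sin (θ : ℂ) = s at *
  generalize batemanPhase ν x θ = p at *
  field_simp
  linear_combination -4 * I * p * ν * h + (4 * I * p * ν * s ^ 2 - 16 * c * s * p) * I_sq

lemma tendsto_cos_sq_mul_batemanPhase (ν x : ℝ) :
    Tendsto (fun φ => ((Real.cos φ : ℂ)) ^ 2 * batemanPhase ν x φ)
      (𝓝[<] (Real.pi / 2)) (𝓝 0) := by
  rw [tendsto_zero_iff_norm_tendsto_zero]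
  have h : Tendsto (fun φ => Real.cos φ ^ 2) (𝓝 (Real.pi / 2)) (𝓝 0) := by
    have h := (Real.continuous_cos.tendsto (Real.pi / 2)).pow 2
    rwa [Real.cos_pi_div_two, zero_pow two_ne_zero] at h
  refine (h.mono_left nhdsWithin_le_nhds).congr fun φ => ?_
  rw [norm_mul, norm_batemanPhase, norm_pow, norm_real, mul_one, Real.norm_eq_abs, sq_abs]

lemma four_mul_batemanE (ν x : ℝ) :
    4 * x * batemanE ν x = 4 * I + (ν - 2) * batemanE (ν - 2) x + 2 * ν * batemanE ν x
      + (ν + 2) * batemanE (ν + 2) x := by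
  have hi := fun ν => intervalIntegrable_batemanPhase ν x 0 (Real.pi / 2)
  have h0 : Tendsto (fun φ => ((Real.cos φ : ℂ)) ^ 2 * batemanPhase ν x φ) (𝓝[>] 0) (𝓝 1) := by
    have hd := (hasDerivAt_cos_sq_mul_batemanPhase ν x 0 (by simp)).continuousAt.tendsto
    have h1 : ((Real.cos 0 : ℂ)) ^ 2 * batemanPhase ν x 0 = 1 := by simp [batemanPhase]
    exact (h1 ▸ hd).mono_left nhdsWithin_le_nhds
  have key := intervalIntegral.integral_eq_sub_of_hasDerivAt_of_tendsto (by positivity)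
    (fun θ hθ => hasDerivAt_cos_sq_mul_batemanPhase ν x θ (cos_ne_zero_of_mem_Ioo hθ))
    (((((hi _).const_mul _).sub ((hi _).const_mul _)).sub ((hi _).const_mul _)).const_mul _)
    h0 (tendsto_cos_sq_mul_batemanPhase ν x)
  rw [intervalIntegral.integral_const_mul, intervalIntegral.integral_sub
      (((hi _).const_mul _).sub ((hi _).const_mul _)) ((hi _).const_mul _),
    intervalIntegral.integral_sub ((hi _).const_mul _) ((hi _).const_mul _)] at key
  simp only [intervalIntegral.integral_const_mul] at key
  change I * ((x - ν / 2) * batemanE ν x - (ν + 2) / 4 * batemanE (ν + 2) x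
        - (ν - 2) / 4 * batemanE (ν - 2) x) = 0 - 1 at key
  linear_combination (-4 * I) * key + (4 * x * batemanE ν x -
    (ν - 2) * batemanE (ν - 2) x - 2 * ν * batemanE ν x - (ν + 2) * batemanE (ν + 2) x) * I_sq

/-- The derivative of `batemanE ν` at `x ≠ 0`. -/
noncomputable def batemanE' (ν x : ℝ) : ℂ :=
  ((ν - 2) * batemanE (ν - 2) x - (ν + 2) * batemanE (ν + 2) x) / (4 * x)

lemma hasDerivAt_batemanE (ν : ℝ) {x : ℝ} (hx : x ≠ 0) :
    HasDerivAt (batemanE ν) (batemanE' ν x) x := by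
  have hx' : (x : ℂ) ≠ 0 := by exact_mod_cast hx
  have h1 := hasDerivAt_batemanE_add (ν - 2) x
  have h2 := hasDerivAt_batemanE_add ν x
  rw [sub_add_cancel] at h1
  have h3 := (((h1.const_mul ((ν : ℂ) - 2)).add (h2.const_mul ((ν : ℂ) + 2))).const_add
    (4 * I)).div ((hasDerivAt_id x).ofReal_comp.const_mul (4 : ℂ)) (by simpa using hx)
  refine (h3.congr_of_eventuallyEq ?_).congr_deriv ?_
  · filter_upwards [isOpen_ne.mem_nhds hx] with y hy
    have hy' : (y : ℂ) ≠ 0 := by exact_mod_cast hy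
    have := four_mul_batemanE ν y
    simp
    field_simp
    linear_combination this
  · have := four_mul_batemanE ν x
    simp [batemanE']
    field_simp
    linear_combination this

lemma hasDerivAt_batemanE' (ν : ℝ) {x : ℝ} (hx : x ≠ 0) :
    HasDerivAt (batemanE' ν) (((x - ν) * batemanE ν x - I) / x) x := by
  have hx' : (x : ℂ) ≠ 0 := by exact_mod_cast hx
  have e := hasDerivAt_batemanE ν hx
  have h1 := hasDerivAt_batemanE_add (ν - 2) x
  have h2 := hasDerivAt_batemanE_add ν x
  rw [sub_add_cancel] at h1
  have h3 := (((h1.sub e).const_mul ((ν : ℂ) - 2)).sub ((h2.sub e).const_mul ((ν : ℂ) + 2))).div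
    ((hasDerivAt_id x).ofReal_comp.const_mul (4 : ℂ)) (by simpa using hx)
  refine (h3.congr_of_eventuallyEq ?_).congr_deriv ?_
  · filter_upwards with y
    simp [batemanE']
  · have := four_mul_batemanE ν x
    simp [batemanE']
    field_simp
    linear_combination -4 * x * this

lemma norm_batemanE_le_div (ν : ℝ) :
    ∃ C, ∀ x, 0 < x → ‖batemanE ν x‖ ≤ C / x := by
  refine ⟨(4 + ‖(ν : ℂ) - 2‖ * (Real.pi / 2) + ‖2 * (ν : ℂ)‖ * (Real.pi / 2)
    + ‖(ν : ℂ) + 2‖ * (Real.pi / 2)) / 4, fun x hx => ?_⟩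
  have h : ‖4 * (x : ℂ) * batemanE ν x‖ ≤ 4 + ‖(ν : ℂ) - 2‖ * (Real.pi / 2)
      + ‖2 * (ν : ℂ)‖ * (Real.pi / 2) + ‖(ν : ℂ) + 2‖ * (Real.pi / 2) := by
    rw [four_mul_batemanE]
    refine (norm_add₄_le).trans ?_
    rw [norm_mul (ν - 2 : ℂ), norm_mul (2 * ν : ℂ), norm_mul (ν + 2 : ℂ)]
    gcongr
    · simp
    all_goals exact norm_batemanE_le _ _
  rw [norm_mul, norm_mul, norm_real, Real.norm_of_nonneg hx.le] at h
  rw [Complex.norm_ofNat] at h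
  rw [le_div_iff₀ hx]
  linarith

lemma tendsto_batemanE (ν : ℝ) : Tendsto (batemanE ν) atTop (𝓝 0) := by
  obtain ⟨C, hC⟩ := norm_batemanE_le_div ν
  exact squeeze_zero_norm' ((eventually_gt_atTop 0).mono hC)
    (tendsto_const_nhds.div_atTop tendsto_id)

lemma tendsto_batemanE' (ν : ℝ) : Tendsto (batemanE' ν) atTop (𝓝 0) := by
  have h1 : Tendsto (fun x : ℝ => ((x⁻¹ : ℝ) : ℂ)) atTop (𝓝 0) := by
    exact_mod_cast (continuous_ofReal.tendsto 0).comp tendsto_inv_atTop_zero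
  have h := ((((tendsto_batemanE (ν - 2)).const_mul ((ν : ℂ) - 2)).sub
    ((tendsto_batemanE (ν + 2)).const_mul ((ν : ℂ) + 2))).mul h1).mul_const (1 / 4)
  simp only [mul_zero, sub_zero, zero_mul] at h
  refine h.congr fun x => ?_
  rw [batemanE', ofReal_inv]
  ring

lemma batemanK_eq_re (ν x : ℝ) : batemanK ν x = 2 / Real.pi * (batemanE ν x).re := by
  have h := reCLM.intervalIntegral_comp_comm
    (intervalIntegrable_batemanPhase ν x 0 (Real.pi / 2))
  rw [batemanE, ← reCLM_apply, ← h, batemanK]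
  simp only [batemanPhase, reCLM_apply, exp_ofReal_mul_I_re]

lemma havelockH_eq_im (ν x : ℝ) : havelockH ν x = 2 / Real.pi * (batemanE ν x).im := by
  have h := imCLM.intervalIntegral_comp_comm
    (intervalIntegrable_batemanPhase ν x 0 (Real.pi / 2))
  rw [batemanE, ← imCLM_apply, ← h, havelockH]
  simp only [batemanPhase, imCLM_apply, exp_ofReal_mul_I_im]

lemma hasDerivAt_batemanK (ν : ℝ) {x : ℝ} (hx : x ≠ 0) :
    HasDerivAt (batemanK ν) (2 / Real.pi * (batemanE' ν x).re) x := by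
  rw [funext (batemanK_eq_re ν)]
  exact (reCLM.hasFDerivAt.comp_hasDerivAt x (hasDerivAt_batemanE ν hx)).const_mul _

lemma hasDerivAt_havelockH (ν : ℝ) {x : ℝ} (hx : x ≠ 0) :
    HasDerivAt (havelockH ν) (2 / Real.pi * (batemanE' ν x).im) x := by
  rw [funext (havelockH_eq_im ν)]
  exact (imCLM.hasFDerivAt.comp_hasDerivAt x (hasDerivAt_batemanE ν hx)).const_mul _

lemma integrableOn_batemanK_div (ν : ℝ) {x : ℝ} (hx : 0 < x) :
    IntegrableOn (fun t => batemanK ν t / t) (Ioi x) := by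
  obtain ⟨C, hC⟩ := norm_batemanE_le_div ν
  have hint := (integrableOn_Ioi_rpow_of_lt (a := -2) (by norm_num) hx).const_mul
    (2 / Real.pi * C)
  refine hint.mono' ?_ ?_
  · refine ContinuousOn.aestronglyMeasurable (fun t ht => ?_) measurableSet_Ioi
    have ht0 : t ≠ 0 := (hx.trans ht).ne'
    exact ((hasDerivAt_batemanK ν ht0).continuousAt.div continuousAt_id ht0).continuousWithinAt
  · filter_upwards [ae_restrict_mem measurableSet_Ioi] with t ht
    have ht0 : 0 < t := hx.trans ht
    have h1 := (abs_re_le_norm _).trans (hC t ht0)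
    rw [batemanK_eq_re, norm_div, norm_mul, Real.norm_of_nonneg ht0.le,
      Real.norm_of_nonneg (by positivity : 0 ≤ 2 / Real.pi), Real.norm_eq_abs,
      Real.rpow_neg ht0.le, Real.rpow_two, div_le_iff₀ ht0]
    calc 2 / Real.pi * |(batemanE ν t).re| ≤ 2 / Real.pi * (C / t) := by gcongr
      _ = 2 / Real.pi * C * (t ^ 2)⁻¹ * t := by field_simp

lemma integral_batemanK_div (ν : ℝ) {x : ℝ} (hx : 0 < x) :
    ∫ t in Ioi x, batemanK ν t / t = -(2 / Real.pi * ((batemanE' ν x).re * (batemanE ν x).im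
      - (batemanE' ν x).im * (batemanE ν x).re)) := by
  have hd : ∀ t ∈ Ici x, HasDerivAt (fun t => 2 / Real.pi * ((batemanE' ν t).re *
      (batemanE ν t).im - (batemanE' ν t).im * (batemanE ν t).re)) (batemanK ν t / t) t := by
    intro t ht
    have ht0 : t ≠ 0 := (hx.trans_le ht).ne'
    have e := hasDerivAt_batemanE ν ht0
    have e' := hasDerivAt_batemanE' ν ht0
    have r := reCLM.hasFDerivAt.comp_hasDerivAt t e
    have i := imCLM.hasFDerivAt.comp_hasDerivAt t e
    have r' := reCLM.hasFDerivAt.comp_hasDerivAt t e'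
    have i' := imCLM.hasFDerivAt.comp_hasDerivAt t e'
    refine (((r'.mul i).sub (i'.mul r)).const_mul (2 / Real.pi)).congr_deriv ?_
    rw [batemanK_eq_re]
    simp [div_ofReal_re, div_ofReal_im]
    field_simp
    ring
  have hE := tendsto_batemanE ν
  have hE' := tendsto_batemanE' ν
  have hlim := ((((continuous_re.tendsto 0).comp hE').mul ((continuous_im.tendsto 0).comp hE)).sub
    (((continuous_im.tendsto 0).comp hE').mul
      ((continuous_re.tendsto 0).comp hE))).const_mul (2 / Real.pi)
  simp only [zero_re, zero_im, mul_zero, sub_zero] at hlim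
  rw [integral_Ioi_of_hasDerivAt_of_tendsto' hd (integrableOn_batemanK_div ν hx) hlim, zero_sub]

theorem batemanKi_wronskian (n : ℕ) (x : ℝ) (hx : 0 < x) :
    DifferentiableAt ℝ (batemanK (2 * n)) x ∧
    DifferentiableAt ℝ (havelockH (2 * n)) x ∧
    batemanKi n x =
      (Real.pi / 2) * (deriv (batemanK (2 * n)) x * havelockH (2 * n) x -
        deriv (havelockH (2 * n)) x * batemanK (2 * n) x) := by
  have hk := hasDerivAt_batemanK (2 * n) hx.ne'
  have hh := hasDerivAt_havelockH (2 * n) hx.ne'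
  refine ⟨hk.differentiableAt, hh.differentiableAt, ?_⟩
  rw [hk.deriv, hh.deriv, batemanKi, integral_batemanK_div _ hx, batemanK_eq_re, havelockH_eq_im]
  field_simp
end

section
/- For every integer n ≥ 1 and every real s > 0, the Laplace transform of the Bateman-integral function of order 2n is ∫₀^∞ e^{−s x} ki_{2n}(x) dx = (1/(n s)) · ( ((1 − s)/(1 + s))^n − 1 ). -/
open Set MeasureTheory Filter Topology Nat

open scoped FourierTransform

lemma hasDerivAt_cexp_neg_mul_ofReal (a : ℂ) (x : ℝ) :
    HasDerivAt (fun x : ℝ => Complex.exp (-a * x)) (-a * Complex.exp (-a * x)) x := by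
  have h : HasDerivAt (fun x : ℝ => -a * (x : ℂ)) (-a * 1) x :=
    (Complex.ofRealCLM.hasDerivAt (x := x)).const_mul (-a)
  convert! h.cexp using 1
  ring

lemma hasDerivAt_pow_succ_div_factorial_mul_cexp (m : ℕ) (a : ℂ) (x : ℝ) :
    HasDerivAt (fun x : ℝ => (x : ℂ) ^ (m + 1) / (m + 1)! * Complex.exp (-a * x))
      ((x : ℂ) ^ m / m ! * Complex.exp (-a * x)
        - a * ((x : ℂ) ^ (m + 1) / (m + 1)! * Complex.exp (-a * x))) x := by
  have hid : HasDerivAt (fun x : ℝ => (x : ℂ)) 1 x := Complex.ofRealCLM.hasDerivAt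
  have h := ((hid.pow (m + 1)).div_const ((m + 1)! : ℂ)).mul
    (hasDerivAt_cexp_neg_mul_ofReal a x)
  convert! h using 1
  have : (m ! : ℂ) ≠ 0 := by exact_mod_cast m.factorial_ne_zero
  have : (m + 1 : ℂ) ≠ 0 := by exact_mod_cast m.succ_ne_zero
  simp only [Nat.factorial_succ]
  push_cast
  field_simp
  simp
  ring

lemma tendsto_pow_div_factorial_mul_cexp (m : ℕ) {a : ℂ} (ha : 0 < a.re) :
    Tendsto (fun x : ℝ => (x : ℂ) ^ m / m ! * Complex.exp (-a * x)) atTop (𝓝 0) := by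
  rw [tendsto_zero_iff_norm_tendsto_zero]
  have h := (Real.tendsto_pow_mul_exp_neg_atTop_nhds_zero m).comp
    (tendsto_id.const_mul_atTop ha)
  have h2 := h.const_mul (1 / (a.re ^ m * m !))
  rw [mul_zero] at h2
  refine h2.congr' ?_
  filter_upwards [eventually_gt_atTop 0] with x hx
  simp [Complex.norm_exp, abs_of_pos hx, mul_pow]
  field_simp

lemma integrableOn_pow_div_factorial_mul_cexp (m : ℕ) {a : ℂ} (ha : 0 < a.re) :
    IntegrableOn (fun x : ℝ => (x : ℂ) ^ m / m ! * Complex.exp (-a * x)) (Ioi 0) := by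
  have h := (integrableOn_rpow_mul_exp_neg_mul_rpow (p := 1) (s := m) (b := a.re)
    (by linarith [(Nat.cast_nonneg m : (0 : ℝ) ≤ m)]) one_pos ha).const_mul (1 / (m ! : ℝ))
  refine Integrable.mono' h (by fun_prop) ?_
  refine (ae_restrict_mem measurableSet_Ioi).mono fun x (hx : 0 < x) => le_of_eq ?_
  simp [Complex.norm_exp, abs_of_pos hx]
  ring

lemma integral_pow_div_factorial_mul_cexp (m : ℕ) {a : ℂ} (ha : 0 < a.re) :
    ∫ x in Ioi (0 : ℝ), (x : ℂ) ^ m / m ! * Complex.exp (-a * x) = (1 / a) ^ (m + 1) := by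
  have ha0 : a ≠ 0 := by rintro rfl; simp at ha
  induction m with
  | zero =>
    have hint := integrableOn_pow_div_factorial_mul_cexp 0 ha
    have hlim := tendsto_pow_div_factorial_mul_cexp 0 ha
    simp only [pow_zero, Nat.factorial_zero, Nat.cast_one, div_one, one_mul] at hint hlim
    have h := integral_Ioi_of_hasDerivAt_of_tendsto' (a := 0)
      (fun x _ => hasDerivAt_cexp_neg_mul_ofReal a x) (hint.const_mul (-a)) hlim
    rw [integral_const_mul] at h
    simp at h ⊢
    field_simp
    exact h
  | succ m ih =>
    have hint := integrableOn_pow_div_factorial_mul_cexp m ha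
    have hint' := integrableOn_pow_div_factorial_mul_cexp (m + 1) ha
    have h := integral_Ioi_of_hasDerivAt_of_tendsto' (a := 0)
      (fun x _ => hasDerivAt_pow_succ_div_factorial_mul_cexp m a x)
      (hint.sub (hint'.const_mul a)) (tendsto_pow_div_factorial_mul_cexp (m + 1) ha)
    rw [integral_sub hint (hint'.const_mul a), integral_const_mul, ih] at h
    simp only [Complex.ofReal_zero, ne_eq, Nat.succ_ne_zero, not_false_eq_true, zero_pow, zero_div,
      zero_mul, sub_zero] at h
    rw [sub_eq_zero] at h
    rw [pow_succ, h]
    field_simp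

/-- The function `x ↦ x ^ m / m! * exp (-x)`, the density of an Erlang distribution. -/
noncomputable def powExp (m : ℕ) (x : ℝ) : ℝ := x ^ m / m ! * Real.exp (-x)

lemma powExp_mul_cexp (m : ℕ) (s : ℂ) (x : ℝ) : (powExp m x : ℂ) * Complex.exp (-s * x) =
    (x : ℂ) ^ m / m ! * Complex.exp (-(1 + s) * x) := by
  rw [show -(1 + s) * x = -(x : ℂ) + -s * x by ring, Complex.exp_add]
  simp [powExp]
  ring

lemma integrableOn_powExp_mul_cexp (m : ℕ) {s : ℂ} (hs : -1 < s.re) :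
    IntegrableOn (fun x : ℝ => (powExp m x : ℂ) * Complex.exp (-s * x)) (Ioi 0) := by
  simp_rw [powExp_mul_cexp]
  exact integrableOn_pow_div_factorial_mul_cexp m (by simp; linarith)

lemma integral_powExp_mul_cexp (m : ℕ) {s : ℂ} (hs : -1 < s.re) :
    ∫ x in Ioi (0 : ℝ), (powExp m x : ℂ) * Complex.exp (-s * x) = (1 / (1 + s)) ^ (m + 1) := by
  simp_rw [powExp_mul_cexp]
  exact integral_pow_div_factorial_mul_cexp m (by simp; linarith)

lemma integrableOn_powExp_mul_exp (m : ℕ) {s : ℝ} (hs : -1 < s) :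
    IntegrableOn (fun x : ℝ => powExp m x * Real.exp (-s * x)) (Ioi 0) := by
  have h := (integrableOn_powExp_mul_cexp m (s := s) (by simpa)).re
  refine h.congr (Eventually.of_forall fun x => ?_)
  simp only [RCLike.re_eq_complex_re]
  norm_cast

lemma integral_powExp_mul_exp (m : ℕ) {s : ℝ} (hs : -1 < s) :
    ∫ x in Ioi (0 : ℝ), powExp m x * Real.exp (-s * x) = (1 / (1 + s)) ^ (m + 1) := by
  have h := integral_powExp_mul_cexp m (s := s) (by simpa)
  have h2 : ∀ x : ℝ, (powExp m x : ℂ) * Complex.exp (-(s : ℂ) * x) =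
    ((powExp m x * Real.exp (-s * x) : ℝ) : ℂ) := fun x => by push_cast; rfl
  simp_rw [h2] at h
  rw [integral_complex_ofReal] at h
  exact_mod_cast h

lemma integrableOn_powExp (m : ℕ) : IntegrableOn (powExp m) (Ioi 0) := by
  simpa using integrableOn_powExp_mul_exp m (s := 0) (by norm_num)

lemma hasDerivAt_sum_powExp (m : ℕ) (x : ℝ) :
    HasDerivAt (fun x => -∑ k ∈ Finset.range (m + 1), powExp k x) (powExp m x) x := by
  have he : HasDerivAt (fun x : ℝ => Real.exp (-x)) (-Real.exp (-x)) x := by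
    simpa using (hasDerivAt_neg x).exp
  induction m with
  | zero => simpa [powExp] using he.fun_neg
  | succ m ih =>
    simp_rw [Finset.sum_range_succ _ (m + 1), neg_add]
    have h := ((hasDerivAt_pow (m + 1) x).div_const ((m + 1)! : ℝ)).mul he
    convert! ih.add h.neg using 1
    have : (m + 1 : ℝ) ≠ 0 := by positivity
    simp only [powExp, Nat.factorial_succ]
    push_cast
    field_simp
    simp

lemma integral_Ioi_powExp (m : ℕ) {x : ℝ} (hx : 0 ≤ x) :
    ∫ t in Ioi x, powExp m t = ∑ k ∈ Finset.range (m + 1), powExp k x := by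
  have hlim : Tendsto (fun x => -∑ k ∈ Finset.range (m + 1), powExp k x) atTop (𝓝 0) := by
    rw [← neg_zero, ← Finset.sum_const_zero (s := Finset.range (m + 1))]
    refine (tendsto_finsetSum _ fun k _ => ?_).neg
    have h := (Real.tendsto_pow_mul_exp_neg_atTop_nhds_zero k).div_const (k ! : ℝ)
    rw [zero_div] at h
    refine h.congr fun x => ?_
    simp only [powExp]
    ring
  rw [integral_Ioi_of_hasDerivAt_of_tendsto' (fun x _ => hasDerivAt_sum_powExp m x)
    ((integrableOn_powExp m).mono_set (Ioi_subset_Ioi hx)) hlim]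
  simp

/-- The coefficients of `batemanK (2 * (N + 1))` in terms of the functions `powExp (m + 1)`. -/
noncomputable def batemanCoeff (N m : ℕ) : ℝ := N.choose m * 2 ^ (m + 1) * (-1) ^ (N - m)

/-- The closed form of `batemanK (2 * (N + 1))` on `[0, ∞)`. -/
noncomputable def batemanPowExp (N : ℕ) (x : ℝ) : ℝ :=
  ∑ m ∈ Finset.range (N + 1), batemanCoeff N m * powExp (m + 1) x

lemma batemanPowExp_zero (N : ℕ) : batemanPowExp N 0 = 0 := by
  simp [batemanPowExp, powExp]

lemma continuous_batemanPowExp (N : ℕ) : Continuous (batemanPowExp N) := by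
  unfold batemanPowExp powExp
  fun_prop

lemma integrableOn_batemanPowExp (N : ℕ) : IntegrableOn (batemanPowExp N) (Ioi 0) :=
  integrable_finsetSum _ fun m _ => (integrableOn_powExp (m + 1)).const_mul _

lemma integrable_batemanPowExp_max (N : ℕ) :
    Integrable (fun x : ℝ => (batemanPowExp N (max x 0) : ℂ)) := by
  refine Integrable.ofReal (f := fun x : ℝ => batemanPowExp N (max x 0)) ?_
  refine IntegrableOn.integrable_of_forall_notMem_eq_zero (s := Ioi 0) ?_ fun x hx => ?_
  · exact (integrableOn_batemanPowExp N).congr_fun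
      (fun x (hx : 0 < x) => by simp only [max_eq_left hx.le]) measurableSet_Ioi
  · rw [max_eq_right (not_lt.1 hx), batemanPowExp_zero]

lemma integral_batemanPowExp_mul_cexp (N : ℕ) {s : ℂ} (hs : -1 < s.re) :
    ∫ x in Ioi (0 : ℝ), (batemanPowExp N x : ℂ) * Complex.exp (-s * x) =
      2 * (1 / (1 + s)) ^ 2 * ((1 - s) / (1 + s)) ^ N := by
  have hs0 : 1 + s ≠ 0 := fun h => by
    have := congrArg Complex.re h
    simp at this
    linarith
  simp only [batemanPowExp, Complex.ofReal_sum, Complex.ofReal_mul, Finset.sum_mul, mul_assoc]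
  rw [integral_finsetSum _ fun m _ => (integrableOn_powExp_mul_cexp (m + 1) hs).const_mul _]
  simp only [integral_const_mul, integral_powExp_mul_cexp _ hs]
  rw [show (1 - s) / (1 + s) = 2 / (1 + s) + -1 by field_simp; ring, add_pow, Finset.mul_sum,
    Finset.mul_sum]
  refine Finset.sum_congr rfl fun m _ => ?_
  simp only [batemanCoeff]
  push_cast
  ring

lemma fourier_batemanPowExp_max (N : ℕ) (w : ℝ) :
    𝓕 (fun x : ℝ => (batemanPowExp N (max x 0) : ℂ)) w =
      2 / (1 + (2 * Real.pi * w) ^ 2) *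
        ((1 - 2 * Real.pi * w * Complex.I) / (1 + 2 * Real.pi * w * Complex.I)) ^ (N + 1) := by
  have hp : (1 + 2 * Real.pi * w * Complex.I) ≠ 0 := fun h => by
    simpa using congrArg Complex.re h
  have hm : (1 - 2 * Real.pi * w * Complex.I) ≠ 0 := fun h => by
    simpa using congrArg Complex.re h
  have hmul : 1 + (2 * Real.pi * w : ℂ) ^ 2 =
      (1 + 2 * Real.pi * w * Complex.I) * (1 - 2 * Real.pi * w * Complex.I) := by
    linear_combination (2 * Real.pi * w : ℂ) ^ 2 * Complex.I_sq
  rw [Real.fourier_real_eq_integral_exp_smul,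
    ← setIntegral_eq_integral_of_forall_compl_eq_zero (s := Ioi 0)]
  · rw [hmul]
    trans ∫ x in Ioi (0 : ℝ),
      (batemanPowExp N x : ℂ) * Complex.exp (-(2 * Real.pi * w * Complex.I) * x)
    · refine setIntegral_congr_fun measurableSet_Ioi fun x (hx : 0 < x) => ?_
      simp only [max_eq_left hx.le, smul_eq_mul]
      rw [mul_comm]
      congr 2
      push_cast
      ring
    · rw [integral_batemanPowExp_mul_cexp N (by simp), pow_succ _ N]
      field_simp
  · intro x hx
    rw [max_eq_right (not_lt.1 hx), batemanPowExp_zero]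
    simp

lemma integrable_fourier_batemanPowExp_max (N : ℕ) :
    Integrable (𝓕 (fun x : ℝ => (batemanPowExp N (max x 0) : ℂ))) := by
  have h := ((integrable_inv_one_add_sq.comp_mul_left' (R := 2 * Real.pi)
    (by positivity)).const_mul 2)
  have hF := funext (fourier_batemanPowExp_max N)
  rw [hF]
  refine h.mono' (by fun_prop) (Eventually.of_forall fun w => le_of_eq ?_)
  have hconj : (1 - 2 * Real.pi * w * Complex.I) =
      (starRingEnd ℂ) (1 + 2 * Real.pi * w * Complex.I) := by
    simp [sub_eq_add_neg, Complex.conj_ofNat]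
  have hp : ‖(1 + 2 * Real.pi * w * Complex.I)‖ ≠ 0 := norm_ne_zero_iff.2 fun h => by
    simpa using congrArg Complex.re h
  have hr : (1 + (2 * Real.pi * w : ℂ) ^ 2) = ((1 + (2 * Real.pi * w) ^ 2 : ℝ) : ℂ) := by
    push_cast; rfl
  rw [norm_mul, norm_pow, norm_div, norm_div, hconj, RCLike.norm_conj, div_self hp, one_pow, hr,
    Complex.norm_real, Real.norm_of_nonneg (by positivity)]
  simp [div_eq_mul_inv]

lemma one_sub_tan_mul_I_div (θ : ℝ) (h : Real.cos θ ≠ 0) :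
    (1 - Real.tan θ * Complex.I) / (1 + Real.tan θ * Complex.I) =
      Complex.exp (-(2 * θ) * Complex.I) := by
  have hc : Complex.cos θ ≠ 0 := by exact_mod_cast h
  have h1 : 1 + Real.tan θ * Complex.I = Complex.exp (θ * Complex.I) / Complex.cos θ := by
    rw [Complex.exp_mul_I, Complex.ofReal_tan, Complex.tan]
    field_simp
  have h2 : 1 - Real.tan θ * Complex.I = Complex.exp (-θ * Complex.I) / Complex.cos θ := by
    rw [Complex.exp_mul_I, Complex.ofReal_tan, Complex.tan, Complex.cos_neg, Complex.sin_neg]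
    field_simp
    ring
  rw [h1, h2, div_div_div_cancel_right₀ hc, ← Complex.exp_sub]
  congr 1
  ring

lemma batemanPowExp_eq_integral_cexp (N : ℕ) {x : ℝ} (hx : 0 < x) :
    (batemanPowExp N x : ℂ) = ∫ θ in Ioo (-(Real.pi / 2)) (Real.pi / 2), ((1 / Real.pi : ℝ) : ℂ) *
      Complex.exp (((x * Real.tan θ - (2 * ((N + 1 : ℕ) : ℝ)) * θ : ℝ) : ℂ) * Complex.I) := by
  have hc : Continuous (fun x : ℝ => (batemanPowExp N (max x 0) : ℂ)) :=
    Complex.continuous_ofReal.comp ((continuous_batemanPowExp N).comp (by fun_prop))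
  have hinv := congrFun (hc.fourierInv_fourier_eq (integrable_batemanPowExp_max N)
    (integrable_fourier_batemanPowExp_max N)) x
  simp only [max_eq_left hx.le] at hinv
  rw [← hinv, Real.fourierInv_eq']
  have himg : (fun θ => Real.tan θ / (2 * Real.pi)) '' Ioo (-(Real.pi / 2)) (Real.pi / 2) =
      univ := by
    refine univ_subset_iff.1 fun y _ => ?_
    obtain ⟨θ, hθ, h⟩ := Real.surjOn_tan (mem_univ (y * (2 * Real.pi)))
    exact ⟨θ, hθ, by simp only [h]; field_simp⟩
  have hinj : InjOn (fun θ => Real.tan θ / (2 * Real.pi)) (Ioo (-(Real.pi / 2)) (Real.pi / 2)) := by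
    intro a ha b hb hab
    refine Real.injOn_tan ha hb ?_
    have : (2 * Real.pi) ≠ 0 := by positivity
    exact (div_left_inj' this).1 hab
  rw [← setIntegral_univ, ← himg, integral_image_eq_integral_abs_deriv_smul measurableSet_Ioo
    (fun θ hθ => ((Real.hasDerivAt_tan_of_mem_Ioo hθ).div_const _).hasDerivWithinAt) hinj]
  refine setIntegral_congr_fun measurableSet_Ioo fun θ hθ => ?_
  have hcos := (Real.cos_pos_of_mem_Ioo hθ).ne'
  have hcosC : (Real.cos θ : ℂ) ≠ 0 := by exact_mod_cast hcos
  have hpi : (Real.pi : ℂ) ≠ 0 := by exact_mod_cast Real.pi_ne_zero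
  have htan : 2 * Real.pi * ((Real.tan θ / (2 * Real.pi) : ℝ) : ℂ) = Real.tan θ := by
    push_cast
    field_simp
  have hsq : 1 + (Real.tan θ : ℂ) ^ 2 = 1 / (Real.cos θ : ℂ) ^ 2 := by
    have h : 1 + Real.tan θ ^ 2 = 1 / Real.cos θ ^ 2 := by
      rw [one_div, ← Real.inv_one_add_tan_sq hcos, inv_inv]
    exact_mod_cast h
  simp only [fourier_batemanPowExp_max, htan, hsq, one_sub_tan_mul_I_div θ hcos]
  rw [abs_of_nonneg (by positivity), ← Complex.exp_nat_mul]
  have hexp : Complex.exp (((x * Real.tan θ - (2 * ((N + 1 : ℕ) : ℝ)) * θ : ℝ) : ℂ) * Complex.I) =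
      Complex.exp ((2 * Real.pi * inner ℝ (Real.tan θ / (2 * Real.pi)) x : ℝ) * Complex.I) *
        Complex.exp ((N + 1 : ℕ) * (-(2 * θ) * Complex.I)) := by
    rw [← Complex.exp_add]
    congr 1
    simp only [RCLike.inner_apply, conj_trivial]
    push_cast
    field_simp
    ring
  rw [hexp, Complex.real_smul, smul_eq_mul]
  push_cast
  push_cast at hcosC
  field_simp

lemma batemanK_eq_batemanPowExp (N : ℕ) {x : ℝ} (hx : 0 < x) :
    batemanK (2 * ((N + 1 : ℕ) : ℝ)) x = batemanPowExp N x := by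
  set c : ℝ := 2 * ((N + 1 : ℕ) : ℝ)
  have hmeas : Measurable fun θ : ℝ => x * Real.tan θ - c * θ := by
    simp_rw [Real.tan_eq_sin_div_cos]
    fun_prop
  have hint : IntegrableOn (fun θ : ℝ => ((1 / Real.pi : ℝ) : ℂ) *
      Complex.exp (((x * Real.tan θ - c * θ : ℝ) : ℂ) * Complex.I))
      (Ioo (-(Real.pi / 2)) (Real.pi / 2)) := by
    refine Integrable.const_mul ?_ _
    refine IntegrableOn.of_bound (by simp) (C := 1) ?_ ?_
    · exact (Complex.measurable_exp.comp
        ((Complex.measurable_ofReal.comp hmeas).mul_const _)).aestronglyMeasurable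
    · exact Eventually.of_forall fun θ => (Complex.norm_exp_ofReal_mul_I _).le
  have hcos : ∀ a b : ℝ, IntervalIntegrable (fun θ => Real.cos (x * Real.tan θ - c * θ))
      volume a b := fun a b => by
    refine (intervalIntegrable_const (c := (1 : ℝ))).mono_fun
      (Real.measurable_cos.comp hmeas).aestronglyMeasurable
      (Eventually.of_forall fun θ => ?_)
    simpa using Real.abs_cos_le_one _
  have h := congrArg Complex.re (batemanPowExp_eq_integral_cexp N hx)
  have hre := integral_re hint
  simp only [RCLike.re_eq_complex_re, Complex.re_ofReal_mul, Complex.exp_ofReal_mul_I_re] at hre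
  rw [← hre, Complex.ofReal_re, ← integral_Ioc_eq_integral_Ioo,
    ← intervalIntegral.integral_of_le (by linarith [Real.pi_pos]),
    intervalIntegral.integral_const_mul,
    ← intervalIntegral.integral_add_adjacent_intervals (hcos _ 0) (hcos 0 _)] at h
  have heven := intervalIntegral.integral_comp_neg (a := 0) (b := Real.pi / 2)
    (fun θ => Real.cos (x * Real.tan θ - c * θ))
  rw [neg_zero] at heven
  rw [← heven] at h
  have hneg : ∀ θ : ℝ, Real.cos (x * Real.tan (-θ) - c * -θ) = Real.cos (x * Real.tan θ - c * θ) :=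
    fun θ => by rw [← Real.cos_neg, Real.tan_neg]; ring_nf
  simp only [hneg] at h
  rw [h, batemanK]
  ring

lemma batemanKi_eq (N : ℕ) {x : ℝ} (hx : 0 < x) :
    batemanKi (N + 1) x = -∑ m ∈ Finset.range (N + 1), batemanCoeff N m / (m + 1) *
      ∑ k ∈ Finset.range (m + 1), powExp k x := by
  have h : ∀ t ∈ Ioi x, batemanK (2 * ((N + 1 : ℕ) : ℝ)) t / t =
      ∑ m ∈ Finset.range (N + 1), batemanCoeff N m / (m + 1) * powExp m t := by
    intro t ht
    have ht0 : 0 < t := hx.trans ht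
    rw [batemanK_eq_batemanPowExp N ht0, batemanPowExp, Finset.sum_div]
    refine Finset.sum_congr rfl fun m _ => ?_
    have : (m + 1 : ℝ) ≠ 0 := by positivity
    simp only [powExp, Nat.factorial_succ]
    push_cast
    field_simp
    ring
  rw [batemanKi, setIntegral_congr_fun measurableSet_Ioi h, integral_finsetSum _ fun m _ =>
    ((integrableOn_powExp m).mono_set (Ioi_subset_Ioi hx.le)).const_mul _]
  simp only [integral_const_mul, integral_Ioi_powExp _ hx.le]

lemma sum_batemanCoeff_div_mul (N : ℕ) (r : ℝ) :
    ∑ m ∈ Finset.range (N + 1), batemanCoeff N m / (m + 1) * r ^ (m + 1) =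
      ((2 * r - 1) ^ (N + 1) - (-1) ^ (N + 1)) / (N + 1) := by
  rw [sub_eq_add_neg (2 * r), add_pow, Finset.sum_range_succ' _ (N + 1)]
  simp only [pow_zero, Nat.sub_zero, Nat.choose_zero_right, Nat.cast_one, one_mul, mul_one,
    add_sub_cancel_right, Finset.sum_div]
  refine Finset.sum_congr rfl fun m _ => ?_
  have h : ((N + 1 : ℕ) : ℝ) * N.choose m = (N + 1).choose (m + 1) * (m + 1 : ℕ) := by
    exact_mod_cast Nat.add_one_mul_choose_eq N m
  push_cast at h
  have : (m + 1 : ℝ) ≠ 0 := by positivity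
  rw [Nat.add_sub_add_right, batemanCoeff]
  field_simp
  linear_combination 2 ^ (m + 1) * r ^ (m + 1) * h

theorem batemanKi_laplace (n : ℕ) (hn : 1 ≤ n) (s : ℝ) (hs : 0 < s) :
    ∫ x in Set.Ioi (0 : ℝ), Real.exp (-s * x) * batemanKi n x =
      (1 / (n * s)) * (((1 - s) / (1 + s)) ^ n - 1) := by
  obtain ⟨N, rfl⟩ := Nat.exists_eq_add_of_le' hn
  have hs1 : -1 < s := by linarith
  have hs0 : 1 + s ≠ 0 := by positivity
  have h : ∀ x ∈ Ioi (0 : ℝ), Real.exp (-s * x) * batemanKi (N + 1) x =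
      ∑ m ∈ Finset.range (N + 1), -(batemanCoeff N m / (m + 1)) *
        ∑ k ∈ Finset.range (m + 1), powExp k x * Real.exp (-s * x) := by
    intro x hx
    rw [batemanKi_eq N hx, ← Finset.sum_neg_distrib, Finset.mul_sum]
    refine Finset.sum_congr rfl fun m _ => ?_
    rw [← Finset.sum_mul]
    ring
  have hgeom : ∀ m : ℕ, ∑ k ∈ Finset.range (m + 1), (1 / (1 + s)) ^ (k + 1) =
      (1 - (1 / (1 + s)) ^ (m + 1)) / s := by
    intro m
    have hr : 1 / (1 + s) * (1 + s) = 1 := by field_simp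
    have hg := geom_sum_mul (1 / (1 + s)) (m + 1)
    simp_rw [pow_succ _ _, ← Finset.sum_mul]
    rw [eq_div_iff hs.ne', ← pow_succ]
    linear_combination (∑ k ∈ Finset.range (m + 1), (1 / (1 + s)) ^ k) * hr - hg
  have hint : ∀ m : ℕ, IntegrableOn (fun x => ∑ k ∈ Finset.range (m + 1),
      powExp k x * Real.exp (-s * x)) (Ioi 0) := fun m =>
    integrable_finsetSum _ fun k _ => integrableOn_powExp_mul_exp k hs1
  rw [setIntegral_congr_fun measurableSet_Ioi h, integral_finsetSum _ fun m _ =>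
    (hint m).const_mul _]
  simp_rw [integral_const_mul, integral_finsetSum _ fun k (_ : k ∈ Finset.range _) =>
    integrableOn_powExp_mul_exp k hs1, integral_powExp_mul_exp _ hs1, hgeom]
  have h1 := sum_batemanCoeff_div_mul N 1
  have h2 := sum_batemanCoeff_div_mul N (1 / (1 + s))
  rw [show 2 * (1 / (1 + s)) - 1 = (1 - s) / (1 + s) by field_simp; ring] at h2
  norm_num at h1
  trans (∑ m ∈ Finset.range (N + 1), batemanCoeff N m / (m + 1) * (1 / (1 + s)) ^ (m + 1)
    - ∑ m ∈ Finset.range (N + 1), batemanCoeff N m / (m + 1)) / s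
  · rw [← Finset.sum_sub_distrib, Finset.sum_div]
    refine Finset.sum_congr rfl fun m _ => ?_
    ring
  · rw [h1, h2]
    push_cast
    field_simp
    ring
end
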